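/- arXiv:2306.15754 — 2 statements merged into one kernel-verified Lean document; each statement's English description precedes it below -/
import Mathlib

section
/- Let p : ℝ² → ℝ be a non-constant polynomial satisfying x·∇p(x) ≤ 0 for all x ∈ ℝ². Then there is no function u ∈ C^∞(ℝ²) solving −Δu = p(x) e^{2u} on ℝ² such that u ≤ C for some constant C and ∫_{ℝ²} |p(x)| e^{2u} dx < ∞. -/
open MeasureTheory Metric Real MvPolynomial

/-- The Euclidean Laplacian of `u : ℝⁿ → ℝ` at `x`. -/
noncomputable def lap {n : ℕ} (u : EuclideanSpace ℝ (Fin n) → ℝ)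
    (x : EuclideanSpace ℝ (Fin n)) : ℝ :=
  ∑ i : Fin n, iteratedFDeriv ℝ 2 u x (fun _ => EuclideanSpace.single i 1)

/-- Evaluation of a real polynomial in two variables at a point of `ℝ²`. -/
noncomputable def evalPoly {n : ℕ} (p : MvPolynomial (Fin n) ℝ)
    (x : EuclideanSpace ℝ (Fin n)) : ℝ :=
  MvPolynomial.eval (fun i => x i) p

open Set Filter Topology Function

/-- Differentiation under the integral sign for jointly continuous integrands. -/
theorem hasDerivAt_intervalIntegral_of_continuous {F F' : ℝ → ℝ → ℝ} {a b : ℝ}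
    (hF : Continuous (uncurry F)) (hF' : Continuous (uncurry F'))
    (hd : ∀ t x, HasDerivAt (fun s => F s x) (F' t x) t) (t : ℝ) :
    HasDerivAt (fun s => ∫ x in a..b, F s x) (∫ x in a..b, F' t x) t := by
  obtain ⟨C, hC⟩ := ((isCompact_Icc (a := t - 1) (b := t + 1)).prod
    (isCompact_uIcc (a := a) (b := b))).exists_bound_of_continuousOn hF'.continuousOn
  refine (intervalIntegral.hasDerivAt_integral_of_dominated_loc_of_deriv_le
    (bound := fun _ => C) (F := F) (F' := F')
    (Icc_mem_nhds (by linarith) (by linarith) : Icc (t - 1) (t + 1) ∈ 𝓝 t)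
    (Eventually.of_forall fun s => ?_) ?_ ?_ ?_ ?_ ?_).2
  · exact (hF.comp (Continuous.prodMk_right s)).aestronglyMeasurable
  · exact (hF.comp (Continuous.prodMk_right t)).intervalIntegrable _ _
  · exact (hF'.comp (Continuous.prodMk_right t)).aestronglyMeasurable
  · exact Eventually.of_forall fun x hx s hs => hC (s, x) ⟨hs, uIoc_subset_uIcc hx⟩
  · exact intervalIntegrable_const
  · exact Eventually.of_forall fun x _ s _ => hd s x

/-- A localized integral estimate for `D` when the second derivative of `Q` is `2 * D - 2 * G`. -/
theorem integral_le_of_second_deriv {Q Q' D G : ℝ → ℝ} {a l : ℝ} (hl : 0 < l)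
    (hQ : ∀ t, HasDerivAt Q (Q' t) t) (hQ' : ∀ t, HasDerivAt Q' (2 * D t - 2 * G t) t)
    (hD : Continuous D) (hG : Continuous G) (hQ0 : ∀ t, 0 ≤ Q t) (hD0 : ∀ t, 0 ≤ D t) :
    ∫ t in (a + l / 4)..(a + 3 * l / 4), D t ≤
      2 * (∫ t in a..(a + l), |G t|) + 32 / l ^ 2 * ∫ t in a..(a + l), Q t := by
  have cQ : Continuous Q := continuous_iff_continuousAt.2 fun t => (hQ t).continuousAt
  have cQ' : Continuous Q' := continuous_iff_continuousAt.2 fun t => (hQ' t).continuousAt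
  set P : ℝ → ℝ := fun s => (s - a) * (a + l - s) with hP
  have cP : Continuous P := by fun_prop
  have key : ∫ t in a..(a + l), (P t ^ 2 * (2 * D t - 2 * G t)
      - (2 * (2 * a + l - 2 * t) ^ 2 - 4 * P t) * Q t) = 0 := by
    have hd : ∀ t, HasDerivAt
        (fun t => P t ^ 2 * Q' t - 2 * P t * (2 * a + l - 2 * t) * Q t)
        (P t ^ 2 * (2 * D t - 2 * G t)
          - (2 * (2 * a + l - 2 * t) ^ 2 - 4 * P t) * Q t) t := by
      intro t
      have h1 : HasDerivAt P (2 * a + l - 2 * t) t := by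
        have := ((hasDerivAt_id t).sub_const a).mul ((hasDerivAt_id t).const_sub (a + l))
        refine this.congr_deriv ?_
        simp only [id]; ring
      have h2 : HasDerivAt (fun t : ℝ => 2 * a + l - 2 * t) (-2) t := by
        simpa using ((hasDerivAt_id t).const_mul 2).const_sub (2 * a + l)
      refine (((h1.pow 2).mul (hQ' t)).sub (((h1.const_mul 2).mul h2).mul (hQ t))).congr_deriv ?_
      simp only [Pi.pow_apply, Pi.mul_apply]
      push_cast; ring
    rw [intervalIntegral.integral_eq_sub_of_hasDerivAt (fun t _ => hd t)
      (Continuous.intervalIntegrable (by fun_prop) _ _)]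
    simp [hP]
  have i1 : IntervalIntegrable (fun t => P t ^ 2 * (2 * D t)) volume a (a + l) :=
    Continuous.intervalIntegrable (by fun_prop) _ _
  have i2 : IntervalIntegrable (fun t => 2 * (l ^ 4 / 16) * |G t| + 2 * l ^ 2 * Q t)
      volume a (a + l) := Continuous.intervalIntegrable (by fun_prop) _ _
  have hle : a ≤ a + l := by linarith
  have up : ∫ t in a..(a + l), P t ^ 2 * (2 * D t) ≤
      ∫ t in a..(a + l), (2 * (l ^ 4 / 16) * |G t| + 2 * l ^ 2 * Q t) := by
    have : ∫ t in a..(a + l), P t ^ 2 * (2 * D t) = ∫ t in a..(a + l), (P t ^ 2 * (2 * G t)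
      + (2 * (2 * a + l - 2 * t) ^ 2 - 4 * P t) * Q t) := by
      rw [← sub_eq_zero, ← intervalIntegral.integral_sub i1
        (Continuous.intervalIntegrable (by fun_prop) _ _), ← key]
      congr 1; ext t; ring
    rw [this]
    refine intervalIntegral.integral_mono_on hle
      (Continuous.intervalIntegrable (by fun_prop) _ _) i2 fun t ht => ?_
    have p0 : 0 ≤ P t := mul_nonneg (by linarith [ht.1]) (by linarith [ht.2])
    have p1 : P t ≤ l ^ 2 / 4 := by
      simp only [hP]; nlinarith [sq_nonneg (2 * a + l - 2 * t)]
    have p2 : P t ^ 2 ≤ l ^ 4 / 16 := by nlinarith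
    have p3 : P t ^ 2 * (2 * G t) ≤ 2 * (l ^ 4 / 16) * |G t| := by
      nlinarith [le_abs_self (G t), mul_le_mul_of_nonneg_right p2 (abs_nonneg (G t)),
        mul_le_mul_of_nonneg_left (le_abs_self (G t)) (sq_nonneg (P t))]
    have p4 : 2 * (2 * a + l - 2 * t) ^ 2 - 4 * P t ≤ 2 * l ^ 2 := by
      simp only [hP] at p0 ⊢; nlinarith
    linarith [mul_le_mul_of_nonneg_right p4 (hQ0 t)]
  have low : (9 * l ^ 4 / 128) * ∫ t in (a + l / 4)..(a + 3 * l / 4), D t ≤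
      ∫ t in a..(a + l), P t ^ 2 * (2 * D t) := by
    rw [← intervalIntegral.integral_const_mul]
    refine le_trans ?_ (intervalIntegral.integral_mono_interval (c := a) (d := a + l)
      (a := a + l / 4) (b := a + 3 * l / 4) (by linarith) (by linarith) (by linarith)
      (Eventually.of_forall fun t => by have := hD0 t; positivity) i1)
    refine intervalIntegral.integral_mono_on (by linarith)
      (Continuous.intervalIntegrable (by fun_prop) _ _)
      (Continuous.intervalIntegrable (by fun_prop) _ _) fun t ht => ?_
    have p1 : 3 * l ^ 2 / 16 ≤ P t := by
      simp only [hP]; nlinarith [mul_nonneg (sub_nonneg.2 ht.1) (sub_nonneg.2 ht.2)]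
    have p2 : 9 * l ^ 4 / 256 ≤ P t ^ 2 := by nlinarith [sq_nonneg l]
    nlinarith [mul_le_mul_of_nonneg_right p2 (hD0 t)]
  rw [intervalIntegral.integral_add (Continuous.intervalIntegrable (by fun_prop) _ _)
    (Continuous.intervalIntegrable (by fun_prop) _ _), intervalIntegral.integral_const_mul,
    intervalIntegral.integral_const_mul] at up
  have nG : 0 ≤ ∫ t in a..(a + l), |G t| :=
    intervalIntegral.integral_nonneg hle fun t _ => abs_nonneg _
  have nQ : 0 ≤ ∫ t in a..(a + l), Q t := intervalIntegral.integral_nonneg hle fun t _ => hQ0 t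
  have l4 : 0 < l ^ 4 := by positivity
  have h := low.trans up
  have e : 32 / l ^ 2 * (∫ t in a..(a + l), Q t) * l ^ 4
      = 32 * l ^ 2 * ∫ t in a..(a + l), Q t := by
    field_simp
  have h2 : 0 ≤ l ^ 2 * ∫ t in a..(a + l), Q t := by positivity
  have h3 : 0 ≤ l ^ 4 * ∫ t in a..(a + l), |G t| := by positivity
  refine le_of_mul_le_mul_right ?_ l4
  nlinarith

/-- `f` is `C²` and `2 * π`-periodic in the second variable, with partial derivatives `ft`, `fs`,
`ftt`, `fss`, and it solves `f_tt + f_ss = -h` on the cylinder. -/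
structure CylinderSolution (f ft fs ftt fss h : ℝ → ℝ → ℝ) : Prop where
  cont : Continuous (uncurry f)
  cont_t : Continuous (uncurry ft)
  cont_s : Continuous (uncurry fs)
  cont_tt : Continuous (uncurry ftt)
  cont_ss : Continuous (uncurry fss)
  cont_h : Continuous (uncurry h)
  deriv_t : ∀ t s, HasDerivAt (fun t => f t s) (ft t s) t
  deriv_tt : ∀ t s, HasDerivAt (fun t => ft t s) (ftt t s) t
  deriv_s : ∀ t s, HasDerivAt (f t) (fs t s) s
  deriv_ss : ∀ t s, HasDerivAt (fs t) (fss t s) s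
  periodic : ∀ t, Periodic (f t) (2 * π)
  periodic_s : ∀ t, Periodic (fs t) (2 * π)
  periodic_h : ∀ t, Periodic (h t) (2 * π)
  eqn : ∀ t s, ftt t s + fss t s = -h t s

theorem Function.Periodic.apply_pi {f : ℝ → ℝ} (hf : Periodic f (2 * π)) : f π = f (-π) := by
  rw [← hf (-π)]; congr 1; ring

/-- The mean over the circle. -/
noncomputable def circleMean (f : ℝ → ℝ → ℝ) (t : ℝ) : ℝ := (2 * π)⁻¹ * ∫ s in (-π)..π, f t s

/-- Convolution with the sawtooth kernel; it inverts `∂/∂s` on functions of mean zero. -/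
noncomputable def sawtooth (f : ℝ → ℝ → ℝ) (t s : ℝ) : ℝ :=
  ∫ r in (-π)..π, r / (2 * π) * f t (s + π + r)

theorem continuous_integral_circle {f : ℝ → ℝ → ℝ} (hf : Continuous (uncurry f)) :
    Continuous fun t => ∫ s in (-π)..π, f t s :=
  intervalIntegral.continuous_parametric_intervalIntegral_of_continuous' hf _ _

theorem continuous_circleMean {f : ℝ → ℝ → ℝ} (hf : Continuous (uncurry f)) :
    Continuous (circleMean f) := (continuous_integral_circle hf).const_mul _

theorem hasDerivAt_circleMean {f f' : ℝ → ℝ → ℝ} (hf : Continuous (uncurry f))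
    (hf' : Continuous (uncurry f')) (hd : ∀ t s, HasDerivAt (fun t => f t s) (f' t s) t) (t : ℝ) :
    HasDerivAt (circleMean f) (circleMean f' t) t :=
  (hasDerivAt_intervalIntegral_of_continuous hf hf' hd t).const_mul _

theorem continuous_sawtooth {f : ℝ → ℝ → ℝ} (hf : Continuous (uncurry f)) :
    Continuous (uncurry (sawtooth f)) := by
  refine intervalIntegral.continuous_parametric_intervalIntegral_of_continuous'
    (f := fun (x : ℝ × ℝ) r => r / (2 * π) * f x.1 (x.2 + π + r)) ?_ _ _
  have : Continuous fun x : (ℝ × ℝ) × ℝ => f x.1.1 (x.1.2 + π + x.2) :=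
    hf.comp (f := fun x : (ℝ × ℝ) × ℝ => (x.1.1, x.1.2 + π + x.2)) (by fun_prop)
  exact (continuous_snd.div_const _).mul this

theorem hasDerivAt_sawtooth_left {f f' : ℝ → ℝ → ℝ} (hf : Continuous (uncurry f))
    (hf' : Continuous (uncurry f')) (hd : ∀ t s, HasDerivAt (fun t => f t s) (f' t s) t)
    (t s : ℝ) : HasDerivAt (fun t => sawtooth f t s) (sawtooth f' t s) t := by
  have aux : ∀ {g : ℝ → ℝ → ℝ}, Continuous (uncurry g) →
      Continuous (uncurry fun t r => r / (2 * π) * g t (s + π + r)) := fun {g} hg =>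
    (continuous_snd.div_const _).mul
      (hg.comp (f := fun x : ℝ × ℝ => (x.1, s + π + x.2)) (by fun_prop))
  exact hasDerivAt_intervalIntegral_of_continuous (aux hf) (aux hf')
    (fun t r => (hd t _).const_mul _) t

theorem hasDerivAt_sawtooth_right {f f' : ℝ → ℝ → ℝ} (hf : Continuous (uncurry f))
    (hf' : Continuous (uncurry f')) (hd : ∀ t s, HasDerivAt (f t) (f' t s) s)
    (t s : ℝ) : HasDerivAt (sawtooth f t) (sawtooth f' t s) s := by
  have aux : ∀ {g : ℝ → ℝ → ℝ}, Continuous (uncurry g) →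
      Continuous (uncurry fun s r => r / (2 * π) * g t (s + π + r)) := fun {g} hg =>
    (continuous_snd.div_const _).mul
      (hg.comp (f := fun x : ℝ × ℝ => (t, x.1 + π + x.2)) (by fun_prop))
  refine hasDerivAt_intervalIntegral_of_continuous (aux hf) (aux hf')
    (fun s r => HasDerivAt.const_mul _ ?_) s
  have := HasDerivAt.comp_add_const s (π + r) (f := f t)
    (by simpa [add_assoc] using hd t (s + π + r))
  simpa [add_assoc] using this

theorem integral_shift_circle {f : ℝ → ℝ} (hf : Periodic f (2 * π)) (s : ℝ) :
    ∫ r in (-π)..π, f (s + π + r) = ∫ r in (-π)..π, f r := by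
  rw [intervalIntegral.integral_comp_add_left (fun r => f r) (s + π)]
  have := hf.intervalIntegral_add_eq s (-π)
  rw [show -π + 2 * π = π by ring] at this
  rw [← this]; congr 1 <;> ring

theorem integral_deriv_circle {f f' : ℝ → ℝ} (hf : Periodic f (2 * π))
    (hf' : Continuous f') (hd : ∀ s, HasDerivAt f (f' s) s) : ∫ s in (-π)..π, f' s = 0 := by
  rw [intervalIntegral.integral_eq_sub_of_hasDerivAt (fun s _ => hd s)
    (hf'.intervalIntegrable _ _), hf.apply_pi, sub_self]

theorem sawtooth_deriv {f f' : ℝ → ℝ → ℝ}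
    (hf' : Continuous (uncurry f')) (hd : ∀ t s, HasDerivAt (f t) (f' t s) s)
    (hp : ∀ t, Periodic (f t) (2 * π)) (t s : ℝ) :
    sawtooth f' t s = f t s - circleMean f t := by
  have h2 : ∀ r, HasDerivAt (fun r => f t (s + π + r)) (f' t (s + π + r)) r := fun r => by
    simpa using (hd t (s + π + r)).comp_const_add (s + π) r
  have c2 : Continuous fun r => f' t (s + π + r) :=
    hf'.comp (f := fun r => (t, s + π + r)) (by fun_prop)
  rw [sawtooth, intervalIntegral.integral_mul_deriv_eq_deriv_mul
    (u := fun r => r / (2 * π)) (fun r _ => (hasDerivAt_id r).div_const (2 * π)) (fun r _ => h2 r)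
    intervalIntegrable_const (c2.intervalIntegrable _ _), intervalIntegral.integral_const_mul,
    integral_shift_circle (hp t), circleMean]
  have : f t (s + π + π) = f t s := by rw [← hp t s]; congr 1; ring
  rw [this, show s + π + -π = s by ring]
  field_simp; ring

theorem abs_sawtooth_le {f : ℝ → ℝ → ℝ} (hf : Continuous (uncurry f))
    (hp : ∀ t, Periodic (f t) (2 * π)) (c t s : ℝ) :
    |sawtooth f t s| ≤ ∫ r in (-π)..π, |f t r - c| := by
  have c2 : Continuous fun r => f t (s + π + r) :=
    hf.comp (f := fun r => (t, s + π + r)) (by fun_prop)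
  have hpi : -π ≤ π := by linarith [pi_pos]
  have : sawtooth f t s = ∫ r in (-π)..π, r / (2 * π) * (f t (s + π + r) - c) := by
    simp only [mul_sub]
    rw [intervalIntegral.integral_sub (Continuous.intervalIntegrable (by fun_prop) _ _)
      (Continuous.intervalIntegrable (by fun_prop) _ _), intervalIntegral.integral_mul_const,
      intervalIntegral.integral_div, integral_id]
    simp [sawtooth]
  have e := integral_shift_circle (f := fun r => |f t r - c|)
    (fun r => by simp only [hp t r]) s
  rw [this, ← e]
  refine (intervalIntegral.abs_integral_le_integral_abs hpi).trans
    (intervalIntegral.integral_mono_on hpi (Continuous.intervalIntegrable (by fun_prop) _ _)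
      (Continuous.intervalIntegrable (by fun_prop) _ _) fun r hr => ?_)
  rw [abs_mul]
  refine mul_le_of_le_one_left (abs_nonneg _) ?_
  rw [abs_div, abs_of_pos (show 0 < 2 * π by positivity), div_le_one (by positivity)]
  exact (abs_le.2 ⟨hr.1, hr.2⟩).trans (by linarith [pi_pos])

namespace CylinderSolution

variable {f ft fs ftt fss h : ℝ → ℝ → ℝ}

theorem energy_estimate (H : CylinderSolution f ft fs ftt fss h) {a l : ℝ} (hl : 0 < l) :
    ∫ t in (a + l / 4)..(a + 3 * l / 4), ∫ s in (-π)..π, fs t s ^ 2 ≤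
      2 * (∫ t in a..(a + l), ∫ s in (-π)..π, |h t s * f t s|)
        + 32 / l ^ 2 * ∫ t in a..(a + l), ∫ s in (-π)..π, f t s ^ 2 := by
  have hpi : -π ≤ π := by linarith [pi_pos]
  have c := H.cont
  have ct := H.cont_t
  have cs := H.cont_s
  have ctt := H.cont_tt
  have css := H.cont_ss
  have ch := H.cont_h
  have sec : ∀ {g : ℝ → ℝ → ℝ}, Continuous (uncurry g) → ∀ t,
      IntervalIntegrable (g t) volume (-π) π :=
    fun {g} hg t => (hg.comp (Continuous.prodMk_right t)).intervalIntegrable _ _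
  have cD : Continuous (uncurry fun t s => ft t s ^ 2 + fs t s ^ 2) := (ct.pow 2).add (cs.pow 2)
  have cG : Continuous (uncurry fun t s => h t s * f t s) := ch.mul c
  have cQ : Continuous (uncurry fun t s => f t s ^ 2) := c.pow 2
  have cQ1 : Continuous (uncurry fun t s => 2 * (f t s * ft t s)) := (c.mul ct).const_mul 2
  have cQ2 : Continuous (uncurry fun t s => 2 * (ft t s * ft t s + f t s * ftt t s)) :=
    ((ct.mul ct).add (c.mul ctt)).const_mul 2
  have cf : Continuous (uncurry fun t s => f t s * fss t s) := c.mul css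
  have cs2 : Continuous (uncurry fun t s => fs t s ^ 2) := cs.pow 2
  have parts : ∀ t, ∫ s in (-π)..π, f t s * fss t s = -∫ s in (-π)..π, fs t s ^ 2 := by
    intro t
    rw [intervalIntegral.integral_mul_deriv_eq_deriv_mul (fun s _ => H.deriv_s t s)
      (fun s _ => H.deriv_ss t s) (sec cs t) (sec css t), (H.periodic t).apply_pi,
      (H.periodic_s t).apply_pi]
    simp [sq]
  have main := integral_le_of_second_deriv (a := a) hl
    (Q := fun t => ∫ s in (-π)..π, f t s ^ 2)
    (Q' := fun t => ∫ s in (-π)..π, 2 * (f t s * ft t s))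
    (D := fun t => ∫ s in (-π)..π, (ft t s ^ 2 + fs t s ^ 2))
    (G := fun t => ∫ s in (-π)..π, h t s * f t s)
    (hasDerivAt_intervalIntegral_of_continuous cQ cQ1 fun t s =>
      ((H.deriv_t t s).pow 2).congr_deriv (by push_cast; ring))
    (fun t => (hasDerivAt_intervalIntegral_of_continuous cQ1 cQ2 (fun t s =>
      ((H.deriv_t t s).mul (H.deriv_tt t s)).const_mul 2) t).congr_deriv (by
        have e : ∀ s, 2 * (ft t s * ft t s + f t s * ftt t s)
            = 2 * (ft t s ^ 2 + fs t s ^ 2) - 2 * (h t s * f t s)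
              - 2 * (f t s * fss t s) - 2 * fs t s ^ 2 := fun s => by
          rw [show ftt t s = -h t s - fss t s by linarith [H.eqn t s]]; ring
        simp only [e]
        rw [intervalIntegral.integral_sub, intervalIntegral.integral_sub,
          intervalIntegral.integral_sub]
        · simp only [intervalIntegral.integral_const_mul]
          rw [parts]; ring
        · exact (sec cD t).const_mul 2
        · exact (sec cG t).const_mul 2
        · exact ((sec cD t).const_mul 2).sub ((sec cG t).const_mul 2)
        · exact (sec cf t).const_mul 2
        · exact (((sec cD t).const_mul 2).sub ((sec cG t).const_mul 2)).sub
            ((sec cf t).const_mul 2)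
        · exact (sec cs2 t).const_mul 2))
    (continuous_integral_circle cD) (continuous_integral_circle cG)
    (fun t => intervalIntegral.integral_nonneg hpi fun s _ => by positivity)
    (fun t => intervalIntegral.integral_nonneg hpi fun s _ => by positivity)
  refine le_trans ?_ (main.trans ?_)
  · refine intervalIntegral.integral_mono_on (by linarith)
      ((continuous_integral_circle cs2).intervalIntegrable _ _)
      ((continuous_integral_circle cD).intervalIntegrable _ _) fun t _ => ?_
    exact intervalIntegral.integral_mono_on hpi (sec cs2 t) (sec cD t) fun s _ => by
      linarith [sq_nonneg (ft t s)]
  · gcongr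
    refine intervalIntegral.integral_mono_on (by linarith)
      ((continuous_integral_circle cG).abs.intervalIntegrable _ _)
      ((continuous_integral_circle (f := fun t s => |h t s * f t s|)
        cG.abs).intervalIntegrable _ _) fun t _ => ?_
    exact intervalIntegral.abs_integral_le_integral_abs hpi

theorem sawtooth (H : CylinderSolution f ft fs ftt fss h) :
    CylinderSolution (sawtooth f) (sawtooth ft) (sawtooth fs) (sawtooth ftt) (sawtooth fss)
      (sawtooth h) where
  cont := continuous_sawtooth H.cont
  cont_t := continuous_sawtooth H.cont_t
  cont_s := continuous_sawtooth H.cont_s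
  cont_tt := continuous_sawtooth H.cont_tt
  cont_ss := continuous_sawtooth H.cont_ss
  cont_h := continuous_sawtooth H.cont_h
  deriv_t := hasDerivAt_sawtooth_left H.cont H.cont_t H.deriv_t
  deriv_tt := hasDerivAt_sawtooth_left H.cont_t H.cont_tt H.deriv_tt
  deriv_s := hasDerivAt_sawtooth_right H.cont H.cont_s H.deriv_s
  deriv_ss := hasDerivAt_sawtooth_right H.cont_s H.cont_ss H.deriv_ss
  periodic t s := by
    refine intervalIntegral.integral_congr fun r _ => ?_
    simp only [← H.periodic t (s + π + r)]
    congr 2; ring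
  periodic_s t s := by
    refine intervalIntegral.integral_congr fun r _ => ?_
    simp only [← H.periodic_s t (s + π + r)]
    congr 2; ring
  periodic_h t s := by
    refine intervalIntegral.integral_congr fun r _ => ?_
    simp only [← H.periodic_h t (s + π + r)]
    congr 2; ring
  eqn t s := by
    have aux : ∀ {g : ℝ → ℝ → ℝ}, Continuous (uncurry g) →
        IntervalIntegrable (fun r => r / (2 * π) * g t (s + π + r)) volume (-π) π :=
      fun {g} hg => ((continuous_id.div_const _).mul
        (hg.comp (f := fun r : ℝ => (t, s + π + r)) (by fun_prop))).intervalIntegrable _ _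
    simp only [_root_.sawtooth]
    rw [← intervalIntegral.integral_add (aux H.cont_tt) (aux H.cont_ss),
      ← intervalIntegral.integral_neg]
    refine intervalIntegral.integral_congr fun r _ => ?_
    simp only [← mul_add, H.eqn, mul_neg]

theorem circleMean_tt (H : CylinderSolution f ft fs ftt fss h) (t : ℝ) :
    circleMean ftt t = -circleMean h t := by
  have sec : ∀ {g : ℝ → ℝ → ℝ}, Continuous (uncurry g) → Continuous (g t) :=
    fun {g} hg => hg.comp (Continuous.prodMk_right t)
  have e : ∀ s, ftt t s = -h t s - fss t s := fun s => by linarith [H.eqn t s]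
  simp only [circleMean, e]
  rw [intervalIntegral.integral_sub (f := fun s => -h t s)
    ((sec H.cont_h).neg.intervalIntegrable _ _)
    ((sec H.cont_ss).intervalIntegrable _ _),
    integral_deriv_circle (H.periodic_s t) (sec H.cont_ss) (H.deriv_ss t),
    intervalIntegral.integral_neg]
  ring

theorem sub_circleMean (H : CylinderSolution f ft fs ftt fss h) :
    CylinderSolution (fun t s => f t s - circleMean f t) (fun t s => ft t s - circleMean ft t) fs
      (fun t s => ftt t s - circleMean ftt t) fss (fun t s => h t s - circleMean h t) where
  cont := H.cont.sub ((continuous_circleMean H.cont).comp continuous_fst)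
  cont_t := H.cont_t.sub ((continuous_circleMean H.cont_t).comp continuous_fst)
  cont_s := H.cont_s
  cont_tt := H.cont_tt.sub ((continuous_circleMean H.cont_tt).comp continuous_fst)
  cont_ss := H.cont_ss
  cont_h := H.cont_h.sub ((continuous_circleMean H.cont_h).comp continuous_fst)
  deriv_t t s := (H.deriv_t t s).sub (hasDerivAt_circleMean H.cont H.cont_t H.deriv_t t)
  deriv_tt t s := (H.deriv_tt t s).sub (hasDerivAt_circleMean H.cont_t H.cont_tt H.deriv_tt t)
  deriv_s t s := (H.deriv_s t s).sub_const _
  deriv_ss := H.deriv_ss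
  periodic t s := by simp only [H.periodic t s]
  periodic_s := H.periodic_s
  periodic_h t s := by simp only [H.periodic_h t s]
  eqn t s := by
    have := H.eqn t s
    have := H.circleMean_tt t
    linarith

theorem hasDerivAt_integral (H : CylinderSolution f ft fs ftt fss h) (t : ℝ) :
    HasDerivAt (fun t => ∫ s in (-π)..π, f t s) (∫ s in (-π)..π, ft t s) t :=
  hasDerivAt_intervalIntegral_of_continuous H.cont H.cont_t H.deriv_t t

/-- The flux through circles has derivative `-∫ h`. -/
theorem hasDerivAt_flux (H : CylinderSolution f ft fs ftt fss h) (t : ℝ) :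
    HasDerivAt (fun t => ∫ s in (-π)..π, ft t s) (-∫ s in (-π)..π, h t s) t := by
  refine (hasDerivAt_intervalIntegral_of_continuous H.cont_t H.cont_tt H.deriv_tt t).congr_deriv ?_
  have := H.circleMean_tt t
  simp only [circleMean] at this
  have h2 : (2 * π)⁻¹ ≠ 0 := by positivity
  exact mul_left_cancel₀ h2 (by linarith)

theorem continuous_flux (H : CylinderSolution f ft fs ftt fss h) :
    Continuous fun t => ∫ s in (-π)..π, ft t s := continuous_integral_circle H.cont_t

theorem exists_flux_limit (H : CylinderSolution f ft fs ftt fss h) {B : ℝ}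
    (hB : ∀ b, 0 ≤ b → ∫ t in 0..b, ∫ s in (-π)..π, |h t s| ≤ B) :
    (∃ m, Tendsto (fun t => ∫ s in (-π)..π, ft t s) atTop (𝓝 m)) ∧
    Tendsto (fun T => ∫ t in (2 * T)..(4 * T), ∫ s in (-π)..π, |h t s|) atTop (𝓝 0) := by
  have hpi : -π ≤ π := by linarith [pi_pos]
  have cabs : Continuous (uncurry fun t s => |h t s|) := H.cont_h.abs
  have cγ := continuous_integral_circle cabs
  have cm := continuous_integral_circle H.cont_h
  have γ0 : ∀ t, 0 ≤ ∫ s in (-π)..π, |h t s| := fun t =>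
    intervalIntegral.integral_nonneg hpi fun s _ => abs_nonneg _
  have iγ : IntegrableOn (fun t => ∫ s in (-π)..π, |h t s|) (Ioi 0) := by
    refine integrableOn_Ioi_of_intervalIntegral_norm_bounded B 0
      (fun b : ℝ => (cγ.integrableOn_Icc (a := 0) (b := b)).mono_set Ioc_subset_Icc_self)
      tendsto_id ?_
    filter_upwards [eventually_ge_atTop 0] with b hb
    simp only [Real.norm_of_nonneg (γ0 _)]
    exact hB b hb
  have im : IntegrableOn (fun t => -∫ s in (-π)..π, h t s) (Ioi 0) :=
    (iγ.mono' cm.aestronglyMeasurable (Eventually.of_forall fun t =>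
      intervalIntegral.abs_integral_le_integral_abs hpi)).neg
  have tγ := intervalIntegral_tendsto_integral_Ioi 0 iγ tendsto_id
  have tm := intervalIntegral_tendsto_integral_Ioi 0 im tendsto_id
  constructor
  · refine ⟨_, (tm.add_const (∫ s in (-π)..π, ft 0 s)).congr fun t => ?_⟩
    rw [id, intervalIntegral.integral_eq_sub_of_hasDerivAt (fun t _ => H.hasDerivAt_flux t)
      (cm.neg.intervalIntegrable _ _)]
    ring
  · have t2 : Tendsto (fun T : ℝ => 2 * T) atTop atTop :=
      tendsto_id.const_mul_atTop (by norm_num)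
    have t4 : Tendsto (fun T : ℝ => 4 * T) atTop atTop :=
      tendsto_id.const_mul_atTop (by norm_num)
    have := (tγ.comp t4).sub (tγ.comp t2)
    rw [sub_self] at this
    refine this.congr fun T => ?_
    simp only [comp, id]
    exact intervalIntegral.integral_interval_sub_left (cγ.intervalIntegrable _ _)
      (cγ.intervalIntegrable _ _)

/-- The deficit `∫ (C - f)` grows at most linearly. -/
theorem exists_deficit_le (H : CylinderSolution f ft fs ftt fss h) {B : ℝ}
    (hB : ∀ b, 0 ≤ b → ∫ t in 0..b, ∫ s in (-π)..π, |h t s| ≤ B) (C : ℝ) :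
    ∃ K, 0 < K ∧ ∀ t, 1 ≤ t → 2 * π * C - ∫ s in (-π)..π, f t s ≤ K * t := by
  have hpi : -π ≤ π := by linarith [pi_pos]
  have cabs : Continuous (uncurry fun t s => |h t s|) := H.cont_h.abs
  have cγ := continuous_integral_circle cabs
  have cm := continuous_integral_circle H.cont_h
  set A := |∫ s in (-π)..π, ft 0 s| + B
  set L := 2 * π * C - ∫ s in (-π)..π, f 0 s
  have hB0 : 0 ≤ B := by simpa using hB 0 le_rfl
  have hA0 : 0 ≤ A := by positivity
  have hA : ∀ t, 0 ≤ t → -A ≤ ∫ s in (-π)..π, ft t s := by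
    intro t ht
    have h1 := intervalIntegral.integral_eq_sub_of_hasDerivAt (a := 0) (b := t)
      (fun t _ => H.hasDerivAt_flux t) (cm.neg.intervalIntegrable _ _)
    have h2 : ∫ t in 0..t, -∫ s in (-π)..π, h t s ≥ -B := by
      have := intervalIntegral.integral_mono_on (μ := volume) ht (cm.intervalIntegrable _ _)
        (cγ.intervalIntegrable _ _) fun t _ =>
        (le_abs_self _).trans (intervalIntegral.abs_integral_le_integral_abs hpi)
      rw [intervalIntegral.integral_neg]
      linarith [hB t ht]
    have := neg_abs_le (∫ s in (-π)..π, ft 0 s)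
    simp only [A]; linarith
  refine ⟨|L| + A + 1, by positivity, fun t ht => ?_⟩
  have h1 := intervalIntegral.integral_eq_sub_of_hasDerivAt (a := 0) (b := t)
      (fun t _ => H.hasDerivAt_integral t) (H.continuous_flux.intervalIntegrable _ _)
  have h2 := intervalIntegral.integral_mono_on (μ := volume) (f := fun _ => -A) (a := 0) (b := t)
    (by linarith) intervalIntegrable_const (H.continuous_flux.intervalIntegrable _ _)
    fun t ht => hA t ht.1
  rw [h1] at h2
  simp only [intervalIntegral.integral_const, smul_eq_mul, sub_zero] at h2
  have h3 : |L| ≤ |L| * t := le_mul_of_one_le_right (abs_nonneg _) ht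
  have h4 : L ≤ |L| := le_abs_self L
  simp only [L] at h3 h4 ⊢
  nlinarith

theorem integral_abs_sub_eq (H : CylinderSolution f ft fs ftt fss h) {C : ℝ}
    (hC : ∀ t s, f t s ≤ C) (t : ℝ) :
    ∫ s in (-π)..π, |f t s - C| = 2 * π * C - ∫ s in (-π)..π, f t s := by
  have : ∀ s, |f t s - C| = C - f t s := fun s => by
    rw [abs_of_nonpos (by linarith [hC t s])]; ring
  simp only [this]
  rw [intervalIntegral.integral_sub (g := f t) intervalIntegrable_const
    ((H.cont.comp (Continuous.prodMk_right t)).intervalIntegrable _ _)]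
  simp only [intervalIntegral.integral_const, smul_eq_mul]; ring

/-- The oscillation of `f` on circles is bounded in `L²` on average. -/
theorem exists_integral_sq_sub_mean_le (H : CylinderSolution f ft fs ftt fss h) {B C : ℝ}
    (hB : ∀ b, 0 ≤ b → ∫ t in 0..b, ∫ s in (-π)..π, |h t s| ≤ B) (hC : ∀ t s, f t s ≤ C) :
    ∃ K, ∀ T, 1 ≤ T →
      ∫ t in (2 * T)..(4 * T), ∫ s in (-π)..π, (f t s - circleMean f t) ^ 2 ≤ K * T := by
  have hpi : -π ≤ π := by linarith [pi_pos]
  obtain ⟨K, hK, hKt⟩ := H.exists_deficit_le hB C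
  refine ⟨20 * π * K * B + 400 * π * K ^ 2, fun T hT => ?_⟩
  have cabs : Continuous (uncurry fun t s => |h t s|) := H.cont_h.abs
  have cγ := continuous_integral_circle cabs
  have cz := H.sawtooth.cont
  have cz2 : Continuous (uncurry fun t s => _root_.sawtooth f t s ^ 2) := cz.pow 2
  have czh : Continuous (uncurry fun t s => |_root_.sawtooth h t s * _root_.sawtooth f t s|) :=
    (H.sawtooth.cont_h.mul cz).abs
  have γ0 : ∀ t, 0 ≤ ∫ s in (-π)..π, |h t s| := fun t =>
    intervalIntegral.integral_nonneg hpi fun s _ => abs_nonneg _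
  have hz : ∀ t ∈ Icc T (T + 4 * T), ∀ s, |_root_.sawtooth f t s| ≤ 5 * K * T := by
    intro t ht s
    refine (abs_sawtooth_le H.cont H.periodic C t s).trans ?_
    rw [H.integral_abs_sub_eq hC]
    refine (hKt t (hT.trans ht.1)).trans ?_
    nlinarith [ht.2]
  have hg : ∀ t s, |_root_.sawtooth h t s| ≤ ∫ s in (-π)..π, |h t s| := fun t s => by
    simpa using abs_sawtooth_le H.cont_h H.periodic_h 0 t s
  have E := H.sawtooth.energy_estimate (a := T) (l := 4 * T) (by linarith)
  rw [show T + 4 * T / 4 = 2 * T by ring, show T + 3 * (4 * T) / 4 = 4 * T by ring] at E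
  simp only [sawtooth_deriv H.cont_s H.deriv_s H.periodic] at E
  have e1 : ∫ t in T..(T + 4 * T), ∫ s in (-π)..π,
      |_root_.sawtooth h t s * _root_.sawtooth f t s| ≤ 10 * π * K * T * B := by
    have : ∫ t in T..(T + 4 * T), ∫ s in (-π)..π, |h t s| ≤ B := by
      refine le_trans ?_ (hB (T + 4 * T) (by linarith))
      exact intervalIntegral.integral_mono_interval (by linarith) (by linarith) le_rfl
        (Eventually.of_forall γ0) (cγ.intervalIntegrable _ _)
    refine le_trans ?_ (mul_le_mul_of_nonneg_left this (by positivity))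
    rw [← intervalIntegral.integral_const_mul]
    refine intervalIntegral.integral_mono_on (by linarith)
      ((continuous_integral_circle czh).intervalIntegrable _ _)
      ((cγ.const_mul _).intervalIntegrable _ _) fun t ht => ?_
    have := intervalIntegral.integral_mono_on hpi (μ := volume)
      ((czh.comp (Continuous.prodMk_right t)).intervalIntegrable _ _)
      (intervalIntegrable_const (c := (∫ s in (-π)..π, |h t s|) * (5 * K * T)))
      fun s _ => (abs_mul _ _).trans_le
        (mul_le_mul (hg t s) (hz t ht s) (abs_nonneg _) (γ0 t))
    refine this.trans (le_of_eq ?_)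
    simp only [intervalIntegral.integral_const, smul_eq_mul]; ring
  have e2 : ∫ t in T..(T + 4 * T), ∫ s in (-π)..π, _root_.sawtooth f t s ^ 2
      ≤ 200 * π * K ^ 2 * T ^ 3 := by
    have := intervalIntegral.integral_mono_on (a := T) (b := T + 4 * T) (μ := volume)
      (g := fun _ => 2 * π * (5 * K * T) ^ 2) (by linarith)
      ((continuous_integral_circle cz2).intervalIntegrable _ _) intervalIntegrable_const
      fun t ht => by
        have := intervalIntegral.integral_mono_on hpi (μ := volume)
          ((cz2.comp (Continuous.prodMk_right t)).intervalIntegrable _ _)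
          (intervalIntegrable_const (c := (5 * K * T) ^ 2)) fun s _ => by
            have := hz t ht s
            exact sq_le_sq' (abs_le.1 this).1 (abs_le.1 this).2
        refine this.trans (le_of_eq ?_)
        simp only [intervalIntegral.integral_const, smul_eq_mul]; ring
    refine this.trans (le_of_eq ?_)
    simp only [intervalIntegral.integral_const, smul_eq_mul]; ring
  refine E.trans ?_
  have hT0 : 0 < T := by linarith
  have e3 : 32 / (4 * T) ^ 2 * (200 * π * K ^ 2 * T ^ 3) = 400 * π * K ^ 2 * T := by
    field_simp; norm_num
  have e4 := mul_le_mul_of_nonneg_left e2 (show 0 ≤ 32 / (4 * T) ^ 2 by positivity)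
  rw [e3] at e4
  linarith

theorem circleMean_le (H : CylinderSolution f ft fs ftt fss h) {C : ℝ}
    (hC : ∀ t s, f t s ≤ C) (t : ℝ) : circleMean f t ≤ C := by
  have h0 : 0 ≤ ∫ s in (-π)..π, |f t s - C| :=
    intervalIntegral.integral_nonneg (by linarith [pi_pos]) fun s _ => abs_nonneg _
  rw [H.integral_abs_sub_eq hC] at h0
  rw [circleMean, inv_mul_le_iff₀ (by positivity)]
  linarith

theorem sub_circleMean_le (H : CylinderSolution f ft fs ftt fss h) {C : ℝ}
    (hC : ∀ t s, f t s ≤ C) (t s : ℝ) :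
    f t s - circleMean f t ≤ 2 * π * C - ∫ s in (-π)..π, f t s := by
  have h0 : 0 ≤ ∫ s in (-π)..π, |f t s - C| :=
    intervalIntegral.integral_nonneg (by linarith [pi_pos]) fun s _ => abs_nonneg _
  rw [H.integral_abs_sub_eq hC] at h0
  have e : C - circleMean f t = (2 * π)⁻¹ * (2 * π * C - ∫ s in (-π)..π, f t s) := by
    rw [circleMean]; field_simp
  have h1 : (2 * π)⁻¹ ≤ 1 := inv_le_one_of_one_le₀ (by linarith [pi_gt_three])
  linarith [hC t s, mul_le_mul_of_nonneg_right h1 h0]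

theorem integral_abs_sub_circleMean_le (H : CylinderSolution f ft fs ftt fss h) {C : ℝ}
    (hC : ∀ t s, f t s ≤ C) (t : ℝ) :
    ∫ s in (-π)..π, |f t s - circleMean f t| ≤
      2 * (2 * π * C - ∫ s in (-π)..π, f t s) := by
  have hpi : -π ≤ π := by linarith [pi_pos]
  have c : Continuous (f t) := H.cont.comp (Continuous.prodMk_right t)
  have e : C - circleMean f t = (2 * π)⁻¹ * (2 * π * C - ∫ s in (-π)..π, f t s) := by
    rw [circleMean]; field_simp
  have h1 := intervalIntegral.integral_mono_on (μ := volume) hpi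
    (f := fun s => |f t s - circleMean f t|)
    (g := fun s => |f t s - C| + (C - circleMean f t))
    (Continuous.intervalIntegrable (by fun_prop) _ _)
    (Continuous.intervalIntegrable (by fun_prop) _ _) fun s _ => by
      have := abs_add_le (f t s - C) (C - circleMean f t)
      rw [abs_of_nonneg (sub_nonneg.2 (H.circleMean_le hC t))] at this
      simpa using this
  refine h1.trans (le_of_eq ?_)
  rw [intervalIntegral.integral_add (Continuous.intervalIntegrable (by fun_prop) _ _)
    intervalIntegrable_const, H.integral_abs_sub_eq hC, e]
  simp only [intervalIntegral.integral_const, smul_eq_mul]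
  field_simp; ring

/-- The angular energy of `f` tends to zero on average. -/
theorem tendsto_angular_energy (H : CylinderSolution f ft fs ftt fss h) {A B C N : ℝ}
    (hB : ∀ b, 0 ≤ b → ∫ t in 0..b, ∫ s in (-π)..π, |h t s| ≤ B) (hC : ∀ t s, f t s ≤ C)
    (hA : ∀ t s, 0 ≤ t → |h t s| ≤ A * exp (N * t) * exp (2 * f t s)) (hN : 0 ≤ N) :
    Tendsto (fun T => T⁻¹ * ∫ t in (5 / 2 * T)..(7 / 2 * T), ∫ s in (-π)..π, fs t s ^ 2)
      atTop (𝓝 0) := by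
  have hpi : -π ≤ π := by linarith [pi_pos]
  obtain ⟨K, hK, hKt⟩ := H.exists_deficit_le hB C
  obtain ⟨W, hW⟩ := H.exists_integral_sq_sub_mean_le hB hC
  have hA0 : 0 ≤ A := by
    have := (abs_nonneg _).trans (hA 0 0 le_rfl)
    rw [mul_assoc] at this
    exact nonneg_of_mul_nonneg_left this (by positivity)
  set k := 4 * K + 4 * N + 1
  have τ0 := (H.exists_flux_limit hB).2
  have cabs : Continuous (uncurry fun t s => |h t s|) := H.cont_h.abs
  have cγ := continuous_integral_circle cabs
  have γ0 : ∀ t, 0 ≤ ∫ s in (-π)..π, |h t s| := fun t =>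
    intervalIntegral.integral_nonneg hpi fun s _ => abs_nonneg _
  have H' := H.sub_circleMean
  have cwh : Continuous (uncurry fun t s =>
      |(h t s - circleMean h t) * (f t s - circleMean f t)|) := (H'.cont_h.mul H'.cont).abs
  have pt : ∀ T, 1 ≤ T → ∀ t ∈ Icc (2 * T) (2 * T + 2 * T), ∀ s,
      |h t s| * |f t s - circleMean f t| ≤
        k * T * |h t s| + A * exp (2 * C) * exp (-T) := by
    intro T hT t ht s
    have ht' : t ≤ 4 * T := by linarith [ht.2]
    have r0 : 0 ≤ A * exp (2 * C) * exp (-T) := by positivity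
    by_cases hw : |f t s - circleMean f t| ≤ k * T
    · nlinarith [mul_le_mul_of_nonneg_left hw (abs_nonneg (h t s))]
    · have hneg : f t s - circleMean f t < -(k * T) := by
        by_contra! hcon
        refine hw (abs_le.2 ⟨hcon, ?_⟩)
        refine (H.sub_circleMean_le hC t s).trans ((hKt t (by linarith [ht.1])).trans ?_)
        simp only [k]; nlinarith
      have hkT : 0 ≤ k * T := by positivity
      have hw0 : f t s - circleMean f t < 0 := by linarith
      rw [abs_of_neg hw0]
      set w := f t s - circleMean f t with hwdef
      have e1 : |h t s| ≤ A * exp (2 * C) * exp (4 * N * T) * exp (2 * w) := by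
        refine (hA t s (by linarith [ht.1])).trans ?_
        rw [mul_assoc, mul_assoc, mul_assoc, ← exp_add, ← exp_add, ← exp_add]
        refine mul_le_mul_of_nonneg_left (exp_le_exp.2 ?_) hA0
        have := H.circleMean_le hC t
        nlinarith
      have e2 : exp (2 * w) * -w ≤ exp (-(k * T)) := by
        have a1 : -w ≤ exp (-w) := by linarith [add_one_le_exp (-w)]
        have a2 : exp (2 * w) * -w ≤ exp (2 * w) * exp (-w) := by gcongr
        rw [← exp_add] at a2
        exact a2.trans (exp_le_exp.2 (by linarith))
      calc |h t s| * -w ≤ A * exp (2 * C) * exp (4 * N * T) * exp (2 * w) * -w :=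
            mul_le_mul_of_nonneg_right e1 (by linarith)
        _ = A * exp (2 * C) * exp (4 * N * T) * (exp (2 * w) * -w) := by ring
        _ ≤ A * exp (2 * C) * exp (4 * N * T) * exp (-(k * T)) := by gcongr
        _ = A * exp (2 * C) * exp (4 * N * T - k * T) := by rw [mul_assoc, ← exp_add]; ring_nf
        _ ≤ A * exp (2 * C) * exp (-T) := by
            gcongr; simp only [k]; nlinarith
        _ ≤ _ := le_add_of_nonneg_left (by positivity)
  have slice : ∀ T, 1 ≤ T → ∀ t ∈ Icc (2 * T) (2 * T + 2 * T),
      ∫ s in (-π)..π, |(h t s - circleMean h t) * (f t s - circleMean f t)| ≤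
        (k + 8 * K) * T * (∫ s in (-π)..π, |h t s|) + 2 * π * (A * exp (2 * C) * exp (-T)) := by
    intro T hT t ht
    have hpt := pt T hT t ht
    set R := A * exp (2 * C) * exp (-T)
    have c1 : Continuous (f t) := H.cont.comp (Continuous.prodMk_right t)
    have c2 : Continuous (h t) := H.cont_h.comp (Continuous.prodMk_right t)
    have hm : |circleMean h t| ≤ ∫ s in (-π)..π, |h t s| := by
      rw [circleMean, abs_mul, abs_of_pos (show 0 < (2 * π)⁻¹ by positivity)]
      have h1 : (2 * π)⁻¹ ≤ 1 := inv_le_one_of_one_le₀ (by linarith [pi_gt_three])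
      calc _ ≤ 1 * ∫ s in (-π)..π, |h t s| := by
            gcongr
            exact intervalIntegral.abs_integral_le_integral_abs hpi
        _ = _ := one_mul _
    have h1 := intervalIntegral.integral_mono_on (μ := volume) hpi
      (f := fun s => |(h t s - circleMean h t) * (f t s - circleMean f t)|)
      (g := fun s => k * T * |h t s| + R
        + |circleMean h t| * |f t s - circleMean f t|)
      (Continuous.intervalIntegrable (by fun_prop) _ _)
      (Continuous.intervalIntegrable (by fun_prop) _ _) fun s _ => by
        rw [abs_mul]
        have := abs_sub (h t s) (circleMean h t)
        nlinarith [hpt s, abs_nonneg (f t s - circleMean f t)]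
    rw [intervalIntegral.integral_add (Continuous.intervalIntegrable (by fun_prop) _ _)
      (Continuous.intervalIntegrable (by fun_prop) _ _),
      intervalIntegral.integral_add (Continuous.intervalIntegrable (by fun_prop) _ _)
      intervalIntegrable_const, intervalIntegral.integral_const_mul,
      intervalIntegral.integral_const_mul |circleMean h t|, intervalIntegral.integral_const,
      smul_eq_mul] at h1
    have h2 : ∫ s in (-π)..π, |f t s - circleMean f t| ≤ 8 * K * T := by
      refine (H.integral_abs_sub_circleMean_le hC t).trans ?_
      have := hKt t (by linarith [ht.1])
      nlinarith [ht.2]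
    have h3 := mul_le_mul hm h2
      (intervalIntegral.integral_nonneg hpi fun s _ => abs_nonneg _) (γ0 t)
    linarith
  have bound : ∀ T, 1 ≤ T →
      T⁻¹ * ∫ t in (5 / 2 * T)..(7 / 2 * T), ∫ s in (-π)..π, fs t s ^ 2 ≤
        2 * ((k + 8 * K) * (∫ t in (2 * T)..(4 * T), ∫ s in (-π)..π, |h t s|)
          + 4 * π * (A * exp (2 * C) * exp (-T))) + 8 * W * (T⁻¹) ^ 2 := by
    intro T hT
    have hT0 : 0 < T := by linarith
    have E := H'.energy_estimate (a := 2 * T) (l := 2 * T) (by linarith)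
    have s1 := intervalIntegral.integral_mono_on (μ := volume) (a := 2 * T) (b := 2 * T + 2 * T)
      (by linarith) ((continuous_integral_circle cwh).intervalIntegrable _ _)
      (((cγ.const_mul ((k + 8 * K) * T)).add_const
        (2 * π * (A * exp (2 * C) * exp (-T)))).intervalIntegrable _ _) (slice T hT)
    rw [intervalIntegral.integral_add ((cγ.const_mul _).intervalIntegrable _ _)
      intervalIntegrable_const, intervalIntegral.integral_const_mul,
      intervalIntegral.integral_const, smul_eq_mul] at s1
    have s2 := hW T hT
    rw [show 2 * T + 2 * T / 4 = 5 / 2 * T by ring,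
      show 2 * T + 3 * (2 * T) / 4 = 7 / 2 * T by ring] at E
    rw [show 2 * T + 2 * T = 4 * T by ring] at E s1
    rw [inv_mul_le_iff₀ hT0]
    have s3 := mul_le_mul_of_nonneg_left s2 (show 0 ≤ 32 / (2 * T) ^ 2 by positivity)
    have e3 : 32 / (2 * T) ^ 2 * (W * T) = T * (8 * W * (T⁻¹) ^ 2) := by
      field_simp; ring
    rw [e3] at s3
    linarith
  refine tendsto_of_tendsto_of_tendsto_of_le_of_le' (tendsto_const_nhds (x := (0 : ℝ)))
    (h := fun T => 2 * ((k + 8 * K) * (∫ t in (2 * T)..(4 * T), ∫ s in (-π)..π, |h t s|)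
          + 4 * π * (A * exp (2 * C) * exp (-T))) + 8 * W * (T⁻¹) ^ 2) ?_ ?_ ?_
  · have t1 := ((τ0.const_mul (k + 8 * K)).add
      ((tendsto_exp_neg_atTop_nhds_zero.const_mul (A * exp (2 * C))).const_mul (4 * π))).const_mul 2
    have t2 := ((tendsto_inv_atTop_zero (𝕜 := ℝ)).pow 2).const_mul (8 * W)
    simpa using t1.add t2
  · filter_upwards [eventually_ge_atTop 1] with T hT
    refine mul_nonneg (by positivity) (intervalIntegral.integral_nonneg (by linarith) fun t _ =>
      intervalIntegral.integral_nonneg hpi fun s _ => sq_nonneg _)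
  · filter_upwards [eventually_ge_atTop 1] with T hT using bound T hT

/-- No solution bounded above has flux satisfying a strict Pohozaev-type inequality while
`h` dominates `exp (4 * t + 2 * f)` on a sector. -/
theorem false_of_pohozaev (H : CylinderSolution f ft fs ftt fss h) {A B C N c ε α β t₀ : ℝ}
    (hB : ∀ b, 0 ≤ b → ∫ t in 0..b, ∫ s in (-π)..π, |h t s| ≤ B) (hC : ∀ t s, f t s ≤ C)
    (hA : ∀ t s, 0 ≤ t → |h t s| ≤ A * exp (N * t) * exp (2 * f t s)) (hN : 0 ≤ N)
    (hc : 0 < c) (hα : -π ≤ α) (hαβ : α < β) (hβ : β ≤ π)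
    (hlow : ∀ t s, t₀ ≤ t → s ∈ Icc α β → c * exp (4 * t + 2 * f t s) ≤ |h t s|) (hε : 0 < ε)
    (hpoh : ∀ t, t₀ ≤ t → (∫ s in (-π)..π, ft t s) ^ 2 / (4 * π) + (∫ s in (-π)..π, ft t s) + ε
      ≤ 1 / 2 * (∫ s in (-π)..π, fs t s ^ 2) - 1 / 2 * ∫ s in (-π)..π, h t s) : False := by
  have hpi : -π ≤ π := by linarith [pi_pos]
  obtain ⟨m, hm⟩ := (H.exists_flux_limit hB).1
  have cM := H.continuous_flux
  have cm := continuous_integral_circle H.cont_h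
  have cfs : Continuous (uncurry fun t s => fs t s ^ 2) := H.cont_s.pow 2
  have cs := continuous_integral_circle cfs
  have mlow : -(4 * π) < m := by
    by_contra! hcon
    have h1 : Tendsto (fun t => (∫ s in (-π)..π, ft t s) ^ 2 / (4 * π) + (∫ s in (-π)..π, ft t s)
        + ε) atTop (𝓝 (m ^ 2 / (4 * π) + m + ε)) := (((hm.pow 2).div_const _).add hm).add_const _
    have h2 : ε / 2 < m ^ 2 / (4 * π) + m + ε := by
      have : 0 ≤ m ^ 2 / (4 * π) + m := by
        have e : m ^ 2 / (4 * π) + m = m * (m + 4 * π) / (4 * π) := by field_simp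
        rw [e]
        exact div_nonneg (mul_nonneg_of_nonpos_of_nonpos (by linarith [pi_pos]) (by linarith))
          (by positivity)
      linarith
    obtain ⟨t₁, ht₁⟩ := eventually_atTop.1 (h1.eventually_const_lt h2)
    have lim := (H.tendsto_angular_energy hB hC hA hN).const_mul (1 / 2)
    have t5 : Tendsto (fun T : ℝ => 5 / 2 * T) atTop atTop :=
      tendsto_id.const_mul_atTop (by norm_num)
    have t7 : Tendsto (fun T : ℝ => 7 / 2 * T) atTop atTop :=
      tendsto_id.const_mul_atTop (by norm_num)
    have lim2 := (tendsto_inv_atTop_zero (𝕜 := ℝ)).mul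
      (((hm.comp t7).sub (hm.comp t5)).const_mul (1 / 2))
    have lim3 := lim.add lim2
    have : ε / 2 ≤ 1 / 2 * 0 + 0 * (1 / 2 * (m - m)) := by
      refine ge_of_tendsto lim3 ?_
      filter_upwards [eventually_ge_atTop t₁, eventually_ge_atTop t₀, eventually_gt_atTop 0]
        with T hT1 hT0 hT
      have hI := intervalIntegral.integral_mono_on (μ := volume) (a := 5 / 2 * T) (b := 7 / 2 * T)
        (f := fun _ => ε / 2)
        (g := fun t => 1 / 2 * (∫ s in (-π)..π, fs t s ^ 2) + 1 / 2 * -∫ s in (-π)..π, h t s)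
        (by linarith) intervalIntegrable_const
        (Continuous.intervalIntegrable (by fun_prop) _ _) fun t ht => by
          have a1 := ht₁ t (by linarith [ht.1])
          have a2 := hpoh t (by linarith [ht.1])
          linarith
      rw [intervalIntegral.integral_add (Continuous.intervalIntegrable (by fun_prop) _ _)
        (Continuous.intervalIntegrable (by fun_prop) _ _), intervalIntegral.integral_const_mul,
        intervalIntegral.integral_const_mul, intervalIntegral.integral_eq_sub_of_hasDerivAt
          (fun t _ => H.hasDerivAt_flux t) (cm.neg.intervalIntegrable _ _),
        intervalIntegral.integral_const, smul_eq_mul] at hI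
      have hI2 := mul_le_mul_of_nonneg_left hI (inv_nonneg.2 hT.le)
      have e : T⁻¹ * ((7 / 2 * T - 5 / 2 * T) * (ε / 2)) = ε / 2 := by field_simp; norm_num
      rw [e] at hI2
      simp only [comp]
      linarith
    linarith
  obtain ⟨κ, hκ1, hκ2⟩ := exists_between mlow
  obtain ⟨t₁, ht₁⟩ := eventually_atTop.1 (hm.eventually_const_lt hκ2)
  set δ := 4 + κ / π
  have hδ : 0 < δ := by
    have : -4 < κ / π := by rw [lt_div_iff₀ pi_pos]; linarith
    simp only [δ]; linarith
  set t₂ := max (max t₀ t₁) 1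
  have t20 : t₀ ≤ t₂ := (le_max_left _ _).trans (le_max_left _ _)
  have t21 : t₁ ≤ t₂ := (le_max_right _ _).trans (le_max_left _ _)
  have t22 : 1 ≤ t₂ := le_max_right _ _
  have hV : ∃ D, 0 ≤ D ∧ ∀ t, t₂ ≤ t → δ * t - D ≤ 4 * t + 2 * circleMean f t := by
    refine ⟨|(∫ s in (-π)..π, f t₂ s) / π - κ / π * t₂|, abs_nonneg _, fun t ht => ?_⟩
    have a1 := intervalIntegral.integral_eq_sub_of_hasDerivAt (a := t₂) (b := t)
      (fun t _ => H.hasDerivAt_integral t) (cM.intervalIntegrable _ _)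
    have a2 := intervalIntegral.integral_mono_on (μ := volume) (f := fun _ => κ) ht
      intervalIntegrable_const (cM.intervalIntegrable _ _) fun s hs =>
        (ht₁ s (t21.trans hs.1)).le
    rw [a1, intervalIntegral.integral_const, smul_eq_mul] at a2
    have a3 := neg_abs_le ((∫ s in (-π)..π, f t₂ s) / π - κ / π * t₂)
    have a4 : 2 * circleMean f t = (∫ s in (-π)..π, f t s) / π := by
      rw [circleMean]; field_simp
    have a5 : ((t - t₂) * κ + ∫ s in (-π)..π, f t₂ s) / π ≤ (∫ s in (-π)..π, f t s) / π := by
      gcongr; linarith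
    have a6 : ((t - t₂) * κ + ∫ s in (-π)..π, f t₂ s) / π
      = κ / π * t - κ / π * t₂ + (∫ s in (-π)..π, f t₂ s) / π := by ring
    rw [a4]; simp only [δ]; linarith
  obtain ⟨D, hD, hDt⟩ := hV
  obtain ⟨W, hW⟩ := H.exists_integral_sq_sub_mean_le hB hC
  have hB0 : 0 ≤ B := by simpa using hB 0 le_rfl
  have cabs : Continuous (uncurry fun t s => |h t s|) := H.cont_h.abs
  have cγ := continuous_integral_circle cabs
  have cw : Continuous (uncurry fun t s => (f t s - circleMean f t) ^ 2) :=
    H.sub_circleMean.cont.pow 2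
  have cW := continuous_integral_circle cw
  have γ0 : ∀ t, 0 ≤ ∫ s in (-π)..π, |h t s| := fun t =>
    intervalIntegral.integral_nonneg hpi fun s _ => abs_nonneg _
  have slice : ∀ t, t₂ ≤ t → c * ((β - α) * (δ * t - D) - 4 * π
      - 2 * ∫ s in (-π)..π, (f t s - circleMean f t) ^ 2) ≤ ∫ s in (-π)..π, |h t s| := by
    intro t ht
    have c1 : Continuous (f t) := H.cont.comp (Continuous.prodMk_right t)
    have c2 : Continuous (h t) := H.cont_h.comp (Continuous.prodMk_right t)
    have b1 : ∫ s in α..β, |h t s| ≤ ∫ s in (-π)..π, |h t s| :=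
      intervalIntegral.integral_mono_interval hα hαβ.le hβ
        (Eventually.of_forall fun s => abs_nonneg _) (c2.abs.intervalIntegrable _ _)
    have b2 := intervalIntegral.integral_mono_on (μ := volume) (a := α) (b := β) hαβ.le
      (f := fun s => c * ((δ * t - D) - 2 * (1 + (f t s - circleMean f t) ^ 2)))
      (g := fun s => |h t s|)
      (Continuous.intervalIntegrable (by fun_prop) _ _) (c2.abs.intervalIntegrable _ _)
      fun s hs => by
        refine le_trans ?_ (hlow t s (t20.trans ht) hs)
        refine mul_le_mul_of_nonneg_left ?_ hc.le
        have := add_one_le_exp (4 * t + 2 * f t s)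
        nlinarith [hDt t ht, sq_nonneg (f t s - circleMean f t + 1 / 2)]
    have b3 : ∫ s in α..β, (1 + (f t s - circleMean f t) ^ 2) ≤
        2 * π + ∫ s in (-π)..π, (f t s - circleMean f t) ^ 2 := by
      refine (intervalIntegral.integral_mono_interval hα hαβ.le hβ
        (Eventually.of_forall fun s => ?_)
        (Continuous.intervalIntegrable (by fun_prop) _ _)).trans (le_of_eq ?_)
      · simp only [Pi.zero_apply]; positivity
      · rw [intervalIntegral.integral_add intervalIntegrable_const
          (Continuous.intervalIntegrable (by fun_prop) _ _), intervalIntegral.integral_const,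
          smul_eq_mul]
        ring
    rw [intervalIntegral.integral_const_mul, intervalIntegral.integral_sub
      intervalIntegrable_const (Continuous.intervalIntegrable (by fun_prop) _ _),
      intervalIntegral.integral_const, smul_eq_mul, intervalIntegral.integral_const_mul] at b2
    refine le_trans (mul_le_mul_of_nonneg_left ?_ hc.le) (b2.trans b1)
    linarith
  set E := 2 * (β - α) * D + 8 * π + 2 * W
  have growth : ∀ T, t₂ ≤ T → c * (4 * (β - α) * δ * T ^ 2 - E * T) ≤ B := by
    intro T hT
    have hT1 : 1 ≤ T := t22.trans hT
    have i1 := intervalIntegral.integral_mono_on (μ := volume) (a := 2 * T) (b := 4 * T)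
      (f := fun t => c * (((β - α) * (δ * (2 * T) - D) - 4 * π)
        - 2 * ∫ s in (-π)..π, (f t s - circleMean f t) ^ 2))
      (by linarith) (Continuous.intervalIntegrable (by fun_prop) _ _)
      (cγ.intervalIntegrable _ _) fun t ht => by
        refine le_trans (mul_le_mul_of_nonneg_left ?_ hc.le) (slice t (by linarith [ht.1]))
        have := mul_le_mul_of_nonneg_left ht.1 hδ.le
        have := mul_le_mul_of_nonneg_left this (sub_nonneg.2 hαβ.le)
        linarith
    have i2 : ∫ t in (2 * T)..(4 * T), ∫ s in (-π)..π, |h t s| ≤ B := by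
      refine le_trans ?_ (hB (4 * T) (by linarith))
      exact intervalIntegral.integral_mono_interval (by linarith) (by linarith) le_rfl
        (Eventually.of_forall γ0) (cγ.intervalIntegrable _ _)
    rw [intervalIntegral.integral_const_mul, intervalIntegral.integral_sub
      intervalIntegrable_const (Continuous.intervalIntegrable (by fun_prop) _ _),
      intervalIntegral.integral_const, smul_eq_mul, intervalIntegral.integral_const_mul] at i1
    refine le_trans (mul_le_mul_of_nonneg_left ?_ hc.le) (i1.trans i2)
    have := hW T hT1
    simp only [E]
    linarith
  have hpos : 0 < 4 * (β - α) * δ := by have := sub_pos.2 hαβ; positivity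
  set T := max t₂ ((E + 1 + B / c) / (4 * (β - α) * δ)) with hTdef
  have hT := growth T (le_max_left _ _)
  have hT1 : 1 ≤ T := t22.trans (le_max_left _ _)
  have h3 : E + 1 + B / c ≤ T * (4 * (β - α) * δ) := by
    rw [← div_le_iff₀ hpos]; exact le_max_right _ _
  have h4 : c * ((1 + B / c) * T) ≤ B := by
    refine le_trans (mul_le_mul_of_nonneg_left ?_ hc.le) hT
    have := mul_le_mul_of_nonneg_right h3 (zero_le_one.trans hT1)
    linarith
  have h5 : c * ((1 + B / c) * T) = (c + B) * T := by field_simp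
  rw [h5] at h4
  nlinarith

end CylinderSolution

namespace CylinderSolution

theorem hasDerivAt_pohozaev {f ft fs ftt fss h : ℝ → ℝ → ℝ}
    (H : CylinderSolution f ft fs ftt fss h) {fst ht q : ℝ → ℝ → ℝ}
    (cont_st : Continuous (uncurry fst)) (cont_ht : Continuous (uncurry ht))
    (deriv_st : ∀ t s, HasDerivAt (fun t => fs t s) (fst t s) t)
    (deriv_ts : ∀ t s, HasDerivAt (ft t) (fst t s) s)
    (deriv_h : ∀ t s, HasDerivAt (fun t => h t s) (ht t s) t)
    (periodic_t : ∀ t, Periodic (ft t) (2 * π))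
    (hq : ∀ t s, ht t s = 2 * h t s + 2 * ft t s * h t s + q t s) (t : ℝ) :
    HasDerivAt (fun t => (∫ s in (-π)..π, (ft t s ^ 2 - fs t s ^ 2 + h t s) / 2)
      + ∫ s in (-π)..π, ft t s) ((∫ s in (-π)..π, q t s) / 2) t := by
  have c1 := H.cont_t; have c2 := H.cont_s; have c3 := H.cont_tt; have c4 := H.cont_ss
  have c5 := H.cont_h
  simp only [uncurry_def] at c1 c2 c3 c4 c5 cont_st cont_ht
  have k1 := hasDerivAt_intervalIntegral_of_continuous (a := -π) (b := π)
    (F := fun t s => (ft t s ^ 2 - fs t s ^ 2 + h t s) / 2)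
    (F' := fun t s => (2 * ft t s * ftt t s - 2 * fs t s * fst t s + ht t s) / 2)
    (by simp only [uncurry_def]; fun_prop) (by simp only [uncurry_def]; fun_prop)
    (fun t s => by
      have := (((H.deriv_tt t s).pow 2).sub ((deriv_st t s).pow 2)).add (deriv_h t s)
      refine (this.div_const 2).congr_deriv ?_
      push_cast
      ring) t
  refine (k1.add (H.hasDerivAt_flux t)).congr_deriv ?_
  have k2 : ∫ s in (-π)..π, (fss t s * ft t s + fs t s * fst t s) = 0 :=
    integral_deriv_circle (f := fun s => fs t s * ft t s)
      (fun s => by simp only [H.periodic_s t s, periodic_t t s])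
      (by fun_prop) (fun s => (H.deriv_ss t s).mul (deriv_ts t s))
  have i1 : Continuous fun s => (2 * ft t s * ftt t s - 2 * fs t s * fst t s + ht t s) / 2 := by
    fun_prop
  have i2 : Continuous fun s => fss t s * ft t s + fs t s * fst t s := by fun_prop
  have i3 : Continuous fun s => h t s := by fun_prop
  rw [← sub_eq_add_neg, ← add_zero (_ - _), ← k2, ← intervalIntegral.integral_sub
    (i1.intervalIntegrable _ _) (i3.intervalIntegrable _ _),
    ← intervalIntegral.integral_add ((show Continuous fun s =>
      (2 * ft t s * ftt t s - 2 * fs t s * fst t s + ht t s) / 2 - h t s from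
      i1.sub i3).intervalIntegrable _ _)
    (i2.intervalIntegrable _ _), ← intervalIntegral.integral_div]
  refine intervalIntegral.integral_congr fun s _ => ?_
  have := H.eqn t s
  simp only [hq]
  linear_combination ft t s * this

end CylinderSolution

/-- The point of the unit circle at angle `s`. -/
noncomputable def circlePoint (s : ℝ) : EuclideanSpace ℝ (Fin 2) :=
  cos s • EuclideanSpace.single 0 1 + sin s • EuclideanSpace.single 1 1

/-- The unit tangent vector of the unit circle at angle `s`. -/
noncomputable def circleTangent (s : ℝ) : EuclideanSpace ℝ (Fin 2) :=
  -sin s • EuclideanSpace.single 0 1 + cos s • EuclideanSpace.single 1 1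

/-- Logarithmic polar coordinates on the plane. -/
noncomputable def logPolar (t s : ℝ) : EuclideanSpace ℝ (Fin 2) := exp t • circlePoint s

/-- The angular derivative of `logPolar`. -/
noncomputable def logPolarTangent (t s : ℝ) : EuclideanSpace ℝ (Fin 2) := exp t • circleTangent s

@[fun_prop]
theorem continuous_circlePoint : Continuous circlePoint := by
  unfold circlePoint; fun_prop

@[fun_prop]
theorem continuous_circleTangent : Continuous circleTangent := by
  unfold circleTangent; fun_prop

theorem circlePoint_periodic : Periodic circlePoint (2 * π) := fun s => by simp [circlePoint]

theorem circleTangent_periodic : Periodic circleTangent (2 * π) := fun s => by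
  simp [circleTangent]

theorem hasDerivAt_circlePoint (s : ℝ) : HasDerivAt circlePoint (circleTangent s) s :=
  ((hasDerivAt_cos s).smul_const _).add ((hasDerivAt_sin s).smul_const _)

theorem hasDerivAt_circleTangent (s : ℝ) : HasDerivAt circleTangent (-circlePoint s) s := by
  refine (((hasDerivAt_sin s).neg.smul_const _).add
    ((hasDerivAt_cos s).smul_const _)).congr_deriv ?_
  simp only [circlePoint]
  module

theorem hasDerivAt_logPolar_left (t s : ℝ) :
    HasDerivAt (fun t => logPolar t s) (logPolar t s) t :=
  (Real.hasDerivAt_exp t).smul_const _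

theorem hasDerivAt_logPolar_right (t s : ℝ) :
    HasDerivAt (logPolar t) (logPolarTangent t s) s :=
  (hasDerivAt_circlePoint s).const_smul (exp t)

theorem hasDerivAt_logPolarTangent_left (t s : ℝ) :
    HasDerivAt (fun t => logPolarTangent t s) (logPolarTangent t s) t :=
  (Real.hasDerivAt_exp t).smul_const _

theorem hasDerivAt_logPolarTangent_right (t s : ℝ) :
    HasDerivAt (logPolarTangent t) (-logPolar t s) s := by
  refine ((hasDerivAt_circleTangent s).const_smul (exp t)).congr_deriv ?_
  simp [logPolar]

theorem bilin_circle_trace (B : EuclideanSpace ℝ (Fin 2) →L[ℝ] EuclideanSpace ℝ (Fin 2) →L[ℝ] ℝ)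
    (s : ℝ) : B (circlePoint s) (circlePoint s) + B (circleTangent s) (circleTangent s)
      = ∑ i, B (EuclideanSpace.single i 1) (EuclideanSpace.single i 1) := by
  simp only [circlePoint, circleTangent, map_add, map_smul, add_apply, smul_apply, smul_eq_mul,
    Fin.sum_univ_two]
  linear_combination (B (EuclideanSpace.single 0 1) (EuclideanSpace.single 0 1)
    + B (EuclideanSpace.single 1 1) (EuclideanSpace.single 1 1)) * sin_sq_add_cos_sq s

section Polar

variable {u : EuclideanSpace ℝ (Fin 2) → ℝ}

theorem ContDiff.hasDerivAt_fderiv_apply (hu : ContDiff ℝ 2 u)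
    {x y : ℝ → EuclideanSpace ℝ (Fin 2)} {x' y' : EuclideanSpace ℝ (Fin 2)} {t : ℝ}
    (hx : HasDerivAt x x' t) (hy : HasDerivAt y y' t) :
    HasDerivAt (fun t => fderiv ℝ u (x t) (y t))
      (fderiv ℝ (fderiv ℝ u) (x t) x' (y t) + fderiv ℝ u (x t) y') t := by
  have h1 : ContDiff ℝ 1 (fderiv ℝ u) := hu.fderiv_right (by norm_num)
  exact (((h1.differentiable one_ne_zero (x t)).hasFDerivAt.comp_hasDerivAt t hx).clm_apply hy)

theorem continuous_logPolar : Continuous (fun q : ℝ × ℝ => logPolar q.1 q.2) := by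
  unfold logPolar; fun_prop

theorem continuous_logPolarTangent : Continuous (fun q : ℝ × ℝ => logPolarTangent q.1 q.2) := by
  unfold logPolarTangent; fun_prop

theorem logPolar_periodic (t : ℝ) : Periodic (logPolar t) (2 * π) := fun s => by
  simp only [logPolar, circlePoint_periodic s]

theorem logPolarTangent_periodic (t : ℝ) : Periodic (logPolarTangent t) (2 * π) := fun s => by
  simp only [logPolarTangent, circleTangent_periodic s]

theorem lap_eq_sum_fderiv {n : ℕ} (u : EuclideanSpace ℝ (Fin n) → ℝ)
    (x : EuclideanSpace ℝ (Fin n)) : lap u x =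
      ∑ i, fderiv ℝ (fderiv ℝ u) x (EuclideanSpace.single i 1) (EuclideanSpace.single i 1) := by
  simp [lap, iteratedFDeriv_two_apply]

theorem cylinderSolution_logPolar (hu : ContDiff ℝ 2 u) {K : EuclideanSpace ℝ (Fin 2) → ℝ}
    (hK : Continuous K) (h : ∀ x, -lap u x = K x) :
    CylinderSolution (fun t s => u (logPolar t s))
      (fun t s => fderiv ℝ u (logPolar t s) (logPolar t s))
      (fun t s => fderiv ℝ u (logPolar t s) (logPolarTangent t s))
      (fun t s => fderiv ℝ (fderiv ℝ u) (logPolar t s) (logPolar t s) (logPolar t s)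
        + fderiv ℝ u (logPolar t s) (logPolar t s))
      (fun t s => fderiv ℝ (fderiv ℝ u) (logPolar t s) (logPolarTangent t s) (logPolarTangent t s)
        + fderiv ℝ u (logPolar t s) (-logPolar t s))
      (fun t s => exp (2 * t) * K (logPolar t s)) := by
  have h1 : ContDiff ℝ 1 (fderiv ℝ u) := hu.fderiv_right (by norm_num)
  have d0 := hu.continuous
  have d1 := h1.continuous
  have d2 := h1.continuous_fderiv one_ne_zero
  have c := continuous_logPolar
  have c' := continuous_logPolarTangent
  have hd := fun x => (hu.differentiable two_ne_zero x).hasFDerivAt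
  constructor
  · exact d0.comp c
  · exact (d1.comp c).clm_apply c
  · exact (d1.comp c).clm_apply c'
  · exact (((d2.comp c).clm_apply c).clm_apply c).add ((d1.comp c).clm_apply c)
  · exact (((d2.comp c).clm_apply c').clm_apply c').add ((d1.comp c).clm_apply c.neg)
  · exact (by fun_prop : Continuous fun q : ℝ × ℝ => exp (2 * q.1)).mul (hK.comp c)
  · exact fun t s => (hd _).comp_hasDerivAt t (hasDerivAt_logPolar_left t s)
  · exact fun t s => hu.hasDerivAt_fderiv_apply (hasDerivAt_logPolar_left t s)
      (hasDerivAt_logPolar_left t s)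
  · exact fun t s => (hd _).comp_hasDerivAt s (hasDerivAt_logPolar_right t s)
  · exact fun t s => hu.hasDerivAt_fderiv_apply (hasDerivAt_logPolar_right t s)
      (hasDerivAt_logPolarTangent_right t s)
  · exact fun t s => by simp only [logPolar_periodic t s]
  · exact fun t s => by simp only [logPolar_periodic t s, logPolarTangent_periodic t s]
  · exact fun t s => by simp only [logPolar_periodic t s]
  · intro t s
    rw [← h, lap_eq_sum_fderiv, ← bilin_circle_trace _ s]
    rw [show exp (2 * t) = exp t * exp t by rw [← exp_add]; ring_nf]
    conv_lhs => enter [1, 1]; rw [logPolar]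
    simp only [logPolar, logPolarTangent, map_smul, map_neg, smul_apply,
      smul_eq_mul]
    ring

theorem ContDiff.hasDerivAt_logPolar_angular_left (hu : ContDiff ℝ 2 u) (t s : ℝ) :
    HasDerivAt (fun t => fderiv ℝ u (logPolar t s) (logPolarTangent t s))
      (fderiv ℝ (fderiv ℝ u) (logPolar t s) (logPolar t s) (logPolarTangent t s)
        + fderiv ℝ u (logPolar t s) (logPolarTangent t s)) t :=
  hu.hasDerivAt_fderiv_apply (hasDerivAt_logPolar_left t s) (hasDerivAt_logPolarTangent_left t s)

theorem ContDiff.hasDerivAt_logPolar_radial_right (hu : ContDiff ℝ 2 u) (t s : ℝ) :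
    HasDerivAt (fun s => fderiv ℝ u (logPolar t s) (logPolar t s))
      (fderiv ℝ (fderiv ℝ u) (logPolar t s) (logPolar t s) (logPolarTangent t s)
        + fderiv ℝ u (logPolar t s) (logPolarTangent t s)) s := by
  have hs : IsSymmSndFDerivAt ℝ u (logPolar t s) :=
    hu.contDiffAt.isSymmSndFDerivAt (by simp)
  rw [hs.eq]
  exact hu.hasDerivAt_fderiv_apply (hasDerivAt_logPolar_right t s)
    (hasDerivAt_logPolar_right t s)

end Polar

section Polynomial

variable {n : ℕ} (p : MvPolynomial (Fin n) ℝ)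

theorem continuous_evalPoly : Continuous (evalPoly p) := by
  unfold evalPoly
  exact (MvPolynomial.continuous_eval p).comp (by fun_prop)

theorem evalPoly_smul_of_isHomogeneous {φ : MvPolynomial (Fin n) ℝ} {k : ℕ}
    (hφ : φ.IsHomogeneous k) (r : ℝ) (x : EuclideanSpace ℝ (Fin n)) :
    evalPoly φ (r • x) = r ^ k * evalPoly φ x := by
  simp only [evalPoly, MvPolynomial.eval_eq, Finset.mul_sum]
  refine Finset.sum_congr rfl fun m hm => ?_
  have hk : ∑ i ∈ m.support, m i = k := by
    have := hφ (MvPolynomial.mem_support_iff.mp hm)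
    simpa [Finsupp.weight_apply, Finsupp.sum] using this
  simp only [PiLp.smul_apply, smul_eq_mul, mul_pow, Finset.prod_mul_distrib,
    Finset.prod_pow_eq_pow_sum, hk]
  ring

theorem evalPoly_smul_eq_sum (r : ℝ) (x : EuclideanSpace ℝ (Fin n)) :
    evalPoly p (r • x) = ∑ k ∈ Finset.range (p.totalDegree + 1),
      r ^ k * evalPoly (homogeneousComponent k p) x := by
  conv_lhs => rw [← sum_homogeneousComponent p]
  simp only [evalPoly, map_sum]
  exact Finset.sum_congr rfl fun k _ =>
    evalPoly_smul_of_isHomogeneous (homogeneousComponent_isHomogeneous k p) r x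

theorem radial_derivative_eq_sum (x : EuclideanSpace ℝ (Fin n)) :
    ∑ i, x i * evalPoly (pderiv i p) x = ∑ k ∈ Finset.range (p.totalDegree + 1),
      k * evalPoly (homogeneousComponent k p) x := by
  have h : ∑ i, X i * pderiv i p = ∑ k ∈ Finset.range (p.totalDegree + 1),
      k • homogeneousComponent k p := by
    conv_lhs => rw [← sum_homogeneousComponent p]
    simp only [map_sum, Finset.mul_sum]
    rw [Finset.sum_comm]
    exact Finset.sum_congr rfl fun k _ => (homogeneousComponent_isHomogeneous k p).sum_X_mul_pderiv
  have := congrArg (MvPolynomial.eval fun i => x i) h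
  simpa [evalPoly, map_sum] using this

theorem hasDerivAt_evalPoly_exp_smul (x : EuclideanSpace ℝ (Fin n)) (t : ℝ) :
    HasDerivAt (fun t => evalPoly p (exp t • x))
      (∑ i, (exp t • x) i * evalPoly (pderiv i p) (exp t • x)) t := by
  simp only [radial_derivative_eq_sum, evalPoly_smul_eq_sum p]
  refine HasDerivAt.fun_sum fun k _ => ?_
  rw [evalPoly_smul_of_isHomogeneous (homogeneousComponent_isHomogeneous k p), ← mul_assoc]
  refine HasDerivAt.mul_const ?_ _
  simp only [← exp_nat_mul]
  refine ((hasDerivAt_id' t).const_mul (k : ℝ)).exp.congr_deriv ?_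
  ring

theorem exists_evalPoly_ne_zero {φ : MvPolynomial (Fin n) ℝ} (h : φ ≠ 0) :
    ∃ x, evalPoly φ x ≠ 0 := by
  contrapose! h
  refine MvPolynomial.funext fun x => ?_
  simpa [evalPoly] using h (WithLp.toLp 2 x)

theorem homogeneousComponent_totalDegree_ne_zero {p : MvPolynomial (Fin n) ℝ}
    (hp : 0 < p.totalDegree) : homogeneousComponent p.totalDegree p ≠ 0 := by
  obtain ⟨m, hm, hd⟩ := p.support.exists_mem_eq_sup (by
    rw [MvPolynomial.support_nonempty]; rintro rfl; simp at hp) (fun m => m.sum fun _ e => e)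
  intro h
  have := congrArg (coeff m) h
  rw [coeff_homogeneousComponent, if_pos, coeff_zero] at this
  · exact MvPolynomial.mem_support_iff.mp hm this
  · rw [totalDegree, hd, Finsupp.degree_apply]; rfl

theorem two_le_totalDegree_of_radial_derivative_nonpos {p : MvPolynomial (Fin n) ℝ}
    (hp : 0 < p.totalDegree) (h : ∀ x : EuclideanSpace ℝ (Fin n),
      ∑ i, x i * evalPoly (pderiv i p) x ≤ 0) : 2 ≤ p.totalDegree := by
  by_contra! hlt
  have h1 : p.totalDegree = 1 := by omega
  obtain ⟨x, hx⟩ := exists_evalPoly_ne_zero (homogeneousComponent_totalDegree_ne_zero hp)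
  have key := fun x => h x
  simp only [radial_derivative_eq_sum, h1, Finset.sum_range_succ, Finset.sum_range_zero] at key hx
  have k1 := key x
  have k2 := key ((-1 : ℝ) • x)
  rw [evalPoly_smul_of_isHomogeneous (homogeneousComponent_isHomogeneous 1 p)] at k2
  norm_num at k1 k2
  exact hx (le_antisymm k1 k2)

end Polynomial

section PolynomialPolar

variable (p : MvPolynomial (Fin 2) ℝ)

theorem exists_abs_sum_homogeneousComponent_le (m : ℕ) : ∃ A, 0 ≤ A ∧ ∀ t s, 0 ≤ t →
    |∑ k ∈ Finset.range (m + 1), exp t ^ k * evalPoly (homogeneousComponent k p) (circlePoint s)|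
      ≤ A * exp (m * t) := by
  have hb : ∀ k, ∃ A, ∀ s, |evalPoly (homogeneousComponent k p) (circlePoint s)| ≤ A := by
    intro k
    have hc : Continuous fun s => evalPoly (homogeneousComponent k p) (circlePoint s) :=
      (continuous_evalPoly _).comp continuous_circlePoint
    have hper : Periodic (fun s => evalPoly (homogeneousComponent k p) (circlePoint s)) (2 * π) :=
      fun s => by simp only [circlePoint_periodic s]
    obtain ⟨A, hA⟩ := (hper.isBounded_of_continuous two_pi_pos.ne' hc).exists_norm_le
    exact ⟨A, fun s => hA _ ⟨s, rfl⟩⟩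
  choose A hA using hb
  have hA0 : ∀ k, 0 ≤ A k := fun k => (abs_nonneg _).trans (hA k 0)
  refine ⟨∑ k ∈ Finset.range (m + 1), A k, Finset.sum_nonneg fun k _ => hA0 k, fun t s ht => ?_⟩
  rw [Finset.sum_mul]
  refine (Finset.abs_sum_le_sum_abs _ _).trans (Finset.sum_le_sum fun k hk => ?_)
  rw [abs_mul, abs_of_pos (by positivity), ← exp_nat_mul, mul_comm]
  have hk' : (k : ℝ) ≤ m := by
    exact_mod_cast Nat.lt_succ_iff.mp (Finset.mem_range.mp hk)
  have := hA0 k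
  have := hA k s
  gcongr

theorem exists_abs_evalPoly_logPolar_le : ∃ A, 0 ≤ A ∧ ∀ t s, 0 ≤ t →
    |evalPoly p (logPolar t s)| ≤ A * exp (p.totalDegree * t) := by
  simpa only [logPolar, evalPoly_smul_eq_sum] using
    exists_abs_sum_homogeneousComponent_le p p.totalDegree

theorem exists_eq_norm_smul_circlePoint (x : EuclideanSpace ℝ (Fin 2)) :
    ∃ r : ℝ, ∃ s ∈ Ioc (-π) π, x = r • circlePoint s := by
  refine ⟨‖(⟨x 0, x 1⟩ : ℂ)‖, Complex.arg ⟨x 0, x 1⟩, Complex.arg_mem_Ioc _, ?_⟩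
  ext i
  fin_cases i
  · simp [circlePoint]
  · simp [circlePoint]

theorem exists_le_abs_evalPoly_logPolar (hp : 2 ≤ p.totalDegree) : ∃ c > 0, ∃ α β t₀ : ℝ,
    -π ≤ α ∧ α < β ∧ β ≤ π ∧ ∀ t s, t₀ ≤ t → s ∈ Icc α β →
      c * exp (2 * t) ≤ |evalPoly p (logPolar t s)| := by
  set P := homogeneousComponent p.totalDegree p with hP
  obtain ⟨x, hx⟩ := exists_evalPoly_ne_zero
    (homogeneousComponent_totalDegree_ne_zero (p := p) (by omega))
  obtain ⟨r, s₁, hs₁, rfl⟩ := exists_eq_norm_smul_circlePoint x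
  rw [evalPoly_smul_of_isHomogeneous (homogeneousComponent_isHomogeneous _ p)] at hx
  have hx' : 0 < |evalPoly P (circlePoint s₁)| := abs_pos.mpr (right_ne_zero_of_mul hx)
  set a := |evalPoly P (circlePoint s₁)| with ha
  have hc : Continuous fun s => |evalPoly P (circlePoint s)| :=
    ((continuous_evalPoly _).comp continuous_circlePoint).abs
  obtain ⟨δ, hδ, hδ'⟩ := Metric.eventually_nhds_iff.mp
    (hc.continuousAt.eventually (lt_mem_nhds (half_lt_self hx')))
  obtain ⟨m, hm⟩ : ∃ m, p.totalDegree = m + 1 := ⟨p.totalDegree - 1, by omega⟩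
  obtain ⟨A, hA0, hA⟩ := exists_abs_sum_homogeneousComponent_le p m
  obtain ⟨t₀, ht₀⟩ := ((tendsto_exp_atBot.comp tendsto_neg_atTop_atBot).eventually
    (gt_mem_nhds (show 0 < a / (4 * (A + 1)) by positivity))).exists_forall_of_atTop
  refine ⟨a / 4, by positivity, max (-π) (s₁ - δ / 2), s₁, max t₀ 0, le_max_left _ _,
    max_lt hs₁.1 (by linarith), hs₁.2, fun t s ht hs => ?_⟩
  have h0 : 0 ≤ t := (le_max_right _ _).trans ht
  have h1 := ht₀ t ((le_max_left _ _).trans ht)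
  have h2 : a / 2 < |evalPoly P (circlePoint s)| := hδ' (by
    rw [Real.dist_eq, abs_lt]
    have := (le_max_right _ _).trans hs.1
    constructor <;> linarith [hs.2])
  have h3 := hA t s h0
  have h4 : evalPoly p (logPolar t s) = ∑ k ∈ Finset.range (m + 1),
      exp t ^ k * evalPoly (homogeneousComponent k p) (circlePoint s)
        + exp t ^ (m + 1) * evalPoly P (circlePoint s) := by
    rw [logPolar, evalPoly_smul_eq_sum, hP, hm, Finset.sum_range_succ _ (m + 1)]
  have h5 : exp t ^ (m + 1) = exp (m * t) * exp t := by
    rw [pow_succ, exp_nat_mul]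
  have h6 : |exp t ^ (m + 1) * evalPoly P (circlePoint s)|
      = exp (m * t) * exp t * |evalPoly P (circlePoint s)| := by
    rw [abs_mul, abs_of_pos (by positivity), h5]
  have h7 : exp (2 * t) ≤ exp (m * t) * exp t := by
    rw [← exp_add, exp_le_exp]
    have : (1 : ℝ) ≤ m := by exact_mod_cast (by omega : 1 ≤ m)
    nlinarith
  have h8 : A ≤ a / 4 * exp t := by
    simp only [comp_apply, exp_neg] at h1
    rw [inv_lt_comm₀ (exp_pos t) (by positivity), inv_div, div_lt_iff₀ hx'] at h1
    linarith
  have h9 : A * exp (m * t) ≤ a / 4 * exp t * exp (m * t) := by gcongr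
  have h10 : exp (m * t) * exp t * (a / 2)
      ≤ exp (m * t) * exp t * |evalPoly P (circlePoint s)| := by gcongr
  have h11 : a / 4 * exp (2 * t) ≤ a / 4 * (exp (m * t) * exp t) := by gcongr
  have h12 := abs_sub_abs_le_abs_sub (exp t ^ (m + 1) * evalPoly P (circlePoint s))
    (-∑ k ∈ Finset.range (m + 1),
      exp t ^ k * evalPoly (homogeneousComponent k p) (circlePoint s))
  rw [sub_neg_eq_add, add_comm _ (∑ k ∈ _, _), ← h4, abs_neg, h6] at h12
  linarith

end PolynomialPolar

section Pohozaev

theorem sq_integral_circle_le {g : ℝ → ℝ} (hg : Continuous g) :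
    (∫ s in (-π)..π, g s) ^ 2 ≤ 2 * π * ∫ s in (-π)..π, g s ^ 2 := by
  set m := (∫ s in (-π)..π, g s) / (2 * π) with hm
  have h0 : 0 ≤ ∫ s in (-π)..π, (g s - m) ^ 2 :=
    intervalIntegral.integral_nonneg (by linarith [pi_pos]) fun s _ => sq_nonneg _
  have i1 : IntervalIntegrable (fun s => g s ^ 2) volume (-π) π :=
    (by fun_prop : Continuous fun s => g s ^ 2).intervalIntegrable _ _
  have i2 : IntervalIntegrable (fun s => 2 * m * g s) volume (-π) π :=
    (by fun_prop : Continuous fun s => 2 * m * g s).intervalIntegrable _ _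
  have h1 : ∫ s in (-π)..π, (g s - m) ^ 2 = (∫ s in (-π)..π, g s ^ 2)
      - 2 * m * (∫ s in (-π)..π, g s) + 2 * π * m ^ 2 := by
    have : ∀ s, (g s - m) ^ 2 = g s ^ 2 - 2 * m * g s + m ^ 2 := fun s => by ring
    simp only [this]
    rw [intervalIntegral.integral_add (i1.sub i2) (by simp), intervalIntegral.integral_sub i1 i2,
      intervalIntegral.integral_const_mul, intervalIntegral.integral_const, smul_eq_mul]
    ring
  have hF : ∫ s in (-π)..π, g s = m * (2 * π) := by
    rw [hm]; field_simp
  rw [h1, hF] at h0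
  rw [hF]
  nlinarith [pi_pos, mul_nonneg two_pi_pos.le h0]

variable {u : EuclideanSpace ℝ (Fin 2) → ℝ}

/-- The Pohozaev functional of `u` on the circle of radius `r`. -/
noncomputable def pohozaev (u K : EuclideanSpace ℝ (Fin 2) → ℝ) (t : ℝ) : ℝ :=
  (∫ s in (-π)..π, (fderiv ℝ u (logPolar t s) (logPolar t s) ^ 2
      - fderiv ℝ u (logPolar t s) (logPolarTangent t s) ^ 2
      + exp (2 * t) * K (logPolar t s)) / 2)
    + ∫ s in (-π)..π, fderiv ℝ u (logPolar t s) (logPolar t s)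

theorem tendsto_pohozaev_atBot (hu : ContDiff ℝ 2 u) {K : EuclideanSpace ℝ (Fin 2) → ℝ}
    (hK : Continuous K) : Tendsto (pohozaev u K) atBot (𝓝 0) := by
  have hD : Continuous (fderiv ℝ u) := hu.continuous_fderiv two_ne_zero
  have hω := continuous_circlePoint
  have hτ := continuous_circleTangent
  have c1 : Continuous fun q : ℝ × ℝ =>
      fderiv ℝ u (q.1 • circlePoint q.2) (q.1 • circlePoint q.2) :=
    (hD.comp (by fun_prop)).clm_apply (by fun_prop)
  have c2 : Continuous fun q : ℝ × ℝ =>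
      fderiv ℝ u (q.1 • circlePoint q.2) (q.1 • circleTangent q.2) :=
    (hD.comp (by fun_prop)).clm_apply (by fun_prop)
  have k1 := continuous_integral_circle (f := fun r s =>
    (fderiv ℝ u (r • circlePoint s) (r • circlePoint s) ^ 2
      - fderiv ℝ u (r • circlePoint s) (r • circleTangent s) ^ 2
      + r ^ 2 * K (r • circlePoint s)) / 2) (by simp only [uncurry_def]; fun_prop)
  have k2 := continuous_integral_circle (f := fun r s =>
    fderiv ℝ u (r • circlePoint s) (r • circlePoint s)) c1
  have := ((k1.add k2).tendsto 0).comp tendsto_exp_atBot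
  norm_num at this
  refine this.congr fun t => ?_
  have hexp : exp (2 * t) = exp t ^ 2 := by rw [two_mul, exp_add, sq]
  simp only [comp_apply, pohozaev, logPolar, logPolarTangent, hexp]
  norm_num

theorem exists_pohozaev_le {p : MvPolynomial (Fin 2) ℝ} (hp : 0 < p.totalDegree)
    (hrad : ∀ x : EuclideanSpace ℝ (Fin 2), ∑ i, x i * evalPoly (pderiv i p) x ≤ 0)
    (hu : ContDiff ℝ 2 u) (h : ∀ x, -lap u x = evalPoly p x * exp (2 * u x)) :
    ∃ ε > 0, ∃ t₀, ∀ t, t₀ ≤ t →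
      pohozaev u (fun x => evalPoly p x * exp (2 * u x)) t ≤ -ε := by
  set K : EuclideanSpace ℝ (Fin 2) → ℝ := fun x => evalPoly p x * exp (2 * u x) with hK
  set R : EuclideanSpace ℝ (Fin 2) → ℝ := fun x => ∑ i, x i * evalPoly (pderiv i p) x with hR
  have hu0 := hu.continuous
  have cp := continuous_evalPoly p
  have cK : Continuous K := by fun_prop
  have cR : Continuous R := by
    have := fun i => continuous_evalPoly (pderiv i p)
    fun_prop
  have c := continuous_logPolar
  have H := cylinderSolution_logPolar hu cK h
  have h1 : ContDiff ℝ 1 (fderiv ℝ u) := hu.fderiv_right (by norm_num)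
  have d1 := h1.continuous
  have d2 := h1.continuous_fderiv one_ne_zero
  have c' := continuous_logPolarTangent
  have ct := H.cont_t
  have ch := H.cont_h
  simp only [uncurry_def] at ct ch
  have cq : Continuous fun q : ℝ × ℝ => exp (2 * q.1) * R (logPolar q.1 q.2)
      * exp (2 * u (logPolar q.1 q.2)) := by fun_prop
  have hd : ∀ t, HasDerivAt (pohozaev u K) ((∫ s in (-π)..π, exp (2 * t) * R (logPolar t s)
      * exp (2 * u (logPolar t s))) / 2) t := fun t =>
    H.hasDerivAt_pohozaev
      (ht := fun t s => 2 * (exp (2 * t) * K (logPolar t s))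
        + 2 * fderiv ℝ u (logPolar t s) (logPolar t s) * (exp (2 * t) * K (logPolar t s))
        + exp (2 * t) * R (logPolar t s) * exp (2 * u (logPolar t s)))
      (fst := fun t s => fderiv ℝ (fderiv ℝ u) (logPolar t s) (logPolar t s) (logPolarTangent t s)
        + fderiv ℝ u (logPolar t s) (logPolarTangent t s))
      ((((d2.comp c).clm_apply c).clm_apply c').add ((d1.comp c).clm_apply c'))
      (by simp only [uncurry_def]; fun_prop)
      hu.hasDerivAt_logPolar_angular_left hu.hasDerivAt_logPolar_radial_right
      (fun t s => by
        have e1 := ((hasDerivAt_id' t).const_mul 2).exp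
        have e2 := hasDerivAt_evalPoly_exp_smul p (circlePoint s) t
        have e3 := ((H.deriv_t t s).const_mul 2).exp
        refine (e1.mul (e2.mul e3)).congr_deriv ?_
        simp only [hK, hR, logPolar, Pi.mul_apply]
        ring)
      (fun t s => by simp only [logPolar_periodic t s])
      (fun t s => rfl) t
  have hq : ∀ t s, exp (2 * t) * R (logPolar t s) * exp (2 * u (logPolar t s)) ≤ 0 := fun t s =>
    mul_nonpos_of_nonpos_of_nonneg
      (mul_nonpos_of_nonneg_of_nonpos (exp_pos _).le (hrad _)) (exp_pos _).le
  have hneg : -π ≤ π := by linarith [pi_pos]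
  have hle : ∀ t, (∫ s in (-π)..π, exp (2 * t) * R (logPolar t s)
      * exp (2 * u (logPolar t s))) ≤ 0 := fun t =>
    neg_nonneg.mp (by
      rw [← intervalIntegral.integral_neg]
      exact intervalIntegral.integral_nonneg hneg fun s _ => neg_nonneg.mpr (hq t s))
  have hanti : Antitone (pohozaev u K) :=
    antitone_of_deriv_nonpos (fun t => (hd t).differentiableAt) fun t => by
      rw [(hd t).deriv]; linarith [hle t]
  have hnonpos : ∀ t, pohozaev u K t ≤ 0 := fun t =>
    ge_of_tendsto (tendsto_pohozaev_atBot hu cK)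
      (eventually_le_atBot t |>.mono fun s hs => hanti hs)
  suffices hex : ∃ t, pohozaev u K t < 0 by
    obtain ⟨t₀, ht₀⟩ := hex
    exact ⟨-pohozaev u K t₀, by linarith, t₀, fun t ht => by linarith [hanti ht]⟩
  by_contra! hge
  have hzero : pohozaev u K = fun _ => 0 := funext fun t => le_antisymm (hnonpos t) (hge t)
  obtain ⟨k, hk, α, β, t₀, hα, hαβ, hβ, hlow⟩ := exists_le_abs_evalPoly_logPolar p
    (two_le_totalDegree_of_radial_derivative_nonpos hp hrad)
  have hRz : ∀ t, R (logPolar t α) = 0 := by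
    intro t
    by_contra hne
    have hlt : R (logPolar t α) < 0 := lt_of_le_of_ne (hrad _) hne
    have hI : ∫ s in (-π)..π, exp (2 * t) * R (logPolar t s) * exp (2 * u (logPolar t s)) = 0 := by
      have := (hd t).unique (by rw [hzero]; exact hasDerivAt_const t (0 : ℝ))
      linarith
    have cs : Continuous fun s => -(exp (2 * t) * R (logPolar t s) * exp (2 * u (logPolar t s))) :=
      (cq.comp (Continuous.prodMk_right t)).neg
    have hpos := intervalIntegral.integral_pos (a := -π) (b := π) (by linarith [pi_pos])
      cs.continuousOn (fun s _ => neg_nonneg.mpr (hq t s))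
      ⟨α, ⟨hα, hαβ.le.trans hβ⟩, neg_pos.mpr (mul_neg_of_neg_of_pos
        (mul_neg_of_pos_of_neg (exp_pos _) hlt) (exp_pos _))⟩
    rw [intervalIntegral.integral_neg, hI] at hpos
    simp at hpos
  have hconst : ∀ t, evalPoly p (logPolar t α) = evalPoly p (logPolar 0 α) := fun t =>
    is_const_of_deriv_eq_zero (f := fun t => evalPoly p (logPolar t α))
      (fun t => (hasDerivAt_evalPoly_exp_smul p _ t).differentiableAt)
      (fun t => (hasDerivAt_evalPoly_exp_smul p _ t).deriv.trans (hRz t)) t 0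
  have htop : Tendsto (fun t : ℝ => k * exp (2 * t)) atTop atTop :=
    (tendsto_exp_atTop.comp (tendsto_id.const_mul_atTop two_pos)).const_mul_atTop hk
  obtain ⟨t, ht1, ht2⟩ := ((eventually_ge_atTop t₀).and
    (htop.eventually_gt_atTop |evalPoly p (logPolar 0 α)|)).exists
  have := hlow t α ht1 ⟨le_rfl, hαβ.le⟩
  rw [hconst t] at this
  linarith

end Pohozaev

theorem measurePreserving_toLp_pair :
    MeasurePreserving (fun q : ℝ × ℝ => (!₂[q.1, q.2] : EuclideanSpace ℝ (Fin 2))) :=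
  (PiLp.volume_preserving_toLp (Fin 2)).comp
    ((volume_preserving_finTwoArrow ℝ).symm MeasurableEquiv.finTwoArrow)

theorem ofReal_intervalIntegral_eq_lintegral {g : ℝ → ℝ} (hg : Continuous g) {a b : ℝ}
    (hab : a ≤ b) (h0 : ∀ x ∈ Ioc a b, 0 ≤ g x) :
    ENNReal.ofReal (∫ x in a..b, g x) = ∫⁻ x in Ioc a b, ENNReal.ofReal (g x) := by
  rw [intervalIntegral.integral_of_le hab, ofReal_integral_eq_lintegral_ofReal
    (hg.intervalIntegrable a b).1 ((ae_restrict_iff' measurableSet_Ioc).mpr (.of_forall h0))]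

theorem integral_logPolar_le {g : EuclideanSpace ℝ (Fin 2) → ℝ} (hg : Continuous g)
    (h0 : ∀ x, 0 ≤ g x) (hi : Integrable g) {b : ℝ} (hb : 0 ≤ b) :
    ∫ t in 0..b, ∫ s in (-π)..π, exp (2 * t) * g (logPolar t s) ≤ ∫ x, g x := by
  have hω := continuous_circlePoint
  set M : ℝ → ℝ := fun r => ∫ s in (-π)..π, r * g (r • circlePoint s) with hM
  have cM : Continuous M := continuous_integral_circle (f := fun r s => r * g (r • circlePoint s))
    (by simp only [uncurry_def]; fun_prop)
  have hneg : -π ≤ π := by linarith [pi_pos]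
  have h1 : ∫ t in 0..b, ∫ s in (-π)..π, exp (2 * t) * g (logPolar t s)
      = ∫ r in (1 : ℝ)..exp b, M r := by
    have := intervalIntegral.integral_comp_mul_deriv (a := 0) (b := b) (f := exp) (f' := exp)
      (g := M) (fun t _ => Real.hasDerivAt_exp t) continuous_exp.continuousOn cM
    rw [exp_zero] at this
    rw [← this]
    refine intervalIntegral.integral_congr fun t _ => ?_
    simp only [comp_apply, hM, ← intervalIntegral.integral_mul_const]
    refine intervalIntegral.integral_congr fun s _ => ?_
    simp only [logPolar, two_mul, exp_add]
    ring
  have h2 : ENNReal.ofReal (∫ r in (1 : ℝ)..exp b, M r) ≤ ENNReal.ofReal (∫ x, g x) := by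
    rw [ofReal_intervalIntegral_eq_lintegral cM (one_le_exp hb) fun r hr =>
      intervalIntegral.integral_nonneg hneg fun s _ =>
        mul_nonneg (zero_le_one.trans hr.1.le) (h0 _),
      ofReal_integral_eq_lintegral_ofReal hi (.of_forall h0),
      ← measurePreserving_toLp_pair.lintegral_comp (by fun_prop),
      ← lintegral_comp_polarCoord_symm]
    have hsub : Ioc (1 : ℝ) (exp b) ×ˢ Ioo (-π) π ⊆ polarCoord.target :=
      prod_mono (fun r hr => zero_lt_one.trans hr.1) subset_rfl
    refine le_trans (le_of_eq ?_) (lintegral_mono_set hsub)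
    rw [Measure.volume_eq_prod, ← Measure.prod_restrict, lintegral_prod _ (by
      simp only [polarCoord_symm_apply, smul_eq_mul]
      fun_prop)]
    refine setLIntegral_congr_fun measurableSet_Ioc fun r hr => ?_
    have hr0 : 0 ≤ r := zero_le_one.trans hr.1.le
    simp only [hM]
    rw [ofReal_intervalIntegral_eq_lintegral (by fun_prop) hneg
      (fun s _ => mul_nonneg hr0 (h0 _)), restrict_Ioo_eq_restrict_Ioc]
    refine lintegral_congr fun s => ?_
    rw [ENNReal.ofReal_mul hr0, smul_eq_mul]
    congr 3
    ext i
    fin_cases i <;> simp [circlePoint]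
  rw [h1]
  exact (ENNReal.ofReal_le_ofReal_iff (integral_nonneg h0)).mp h2

/-- If `p` is a non-constant polynomial on `ℝ²` with `x·∇p ≤ 0`, then there is no smooth
solution `u` of `-Δu = p(x) e^{2u}` on `ℝ²` bounded above with `∫ |p| e^{2u} < ∞`. -/
theorem no_solution_nonconstant_polynomial (p : MvPolynomial (Fin 2) ℝ)
    (hp : 0 < p.totalDegree)
    (hrad : ∀ x : EuclideanSpace ℝ (Fin 2),
      ∑ i : Fin 2, x i * evalPoly (MvPolynomial.pderiv i p) x ≤ 0) :
    ¬ ∃ (u : EuclideanSpace ℝ (Fin 2) → ℝ) (C : ℝ),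
      ContDiff ℝ (⊤ : ℕ∞) u ∧
      (∀ x, u x ≤ C) ∧
      (∀ x : EuclideanSpace ℝ (Fin 2), -lap u x = evalPoly p x * Real.exp (2 * u x)) ∧
      Integrable (fun x : EuclideanSpace ℝ (Fin 2) => |evalPoly p x| * Real.exp (2 * u x)) := by
  rintro ⟨u, C, hu, hC, heq, hI⟩
  have hu2 : ContDiff ℝ 2 u := contDiff_infty.mp hu 2
  have hu0 := hu2.continuous
  have cp := continuous_evalPoly p
  have H := cylinderSolution_logPolar hu2
    (K := fun x => evalPoly p x * exp (2 * u x)) (by fun_prop) heq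
  have habs : ∀ t s, |exp (2 * t) * (evalPoly p (logPolar t s) * exp (2 * u (logPolar t s)))|
      = exp (2 * t) * (|evalPoly p (logPolar t s)| * exp (2 * u (logPolar t s))) := fun t s => by
    rw [abs_mul, abs_mul, abs_of_pos (exp_pos _), abs_of_pos (exp_pos _)]
  obtain ⟨A, hA0, hA⟩ := exists_abs_evalPoly_logPolar_le p
  obtain ⟨c, hc, α, β, t₁, hα, hαβ, hβ, hlow⟩ := exists_le_abs_evalPoly_logPolar p
    (two_le_totalDegree_of_radial_derivative_nonpos hp hrad)
  obtain ⟨ε, hε, t₂, hpoh⟩ := exists_pohozaev_le hp hrad hu2 heq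
  refine H.false_of_pohozaev (B := ∫ x, |evalPoly p x| * exp (2 * u x)) (C := C) (A := A)
    (N := p.totalDegree + 2) (c := c) (ε := ε) (α := α) (β := β) (t₀ := max t₁ t₂)
    ?_ (fun t s => hC _) ?_ (by positivity) hc hα hαβ hβ ?_ hε ?_
  · intro b hb
    simp only [habs]
    exact integral_logPolar_le (g := fun x => |evalPoly p x| * exp (2 * u x)) (by fun_prop)
      (fun x => by positivity) hI hb
  · intro t s ht
    rw [habs, ← mul_assoc, add_mul, exp_add]
    have := mul_le_mul_of_nonneg_left (hA t s ht) (exp_pos (2 * t)).le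
    exact mul_le_mul_of_nonneg_right (by linarith) (exp_pos _).le
  · intro t s ht hs
    rw [habs, show 4 * t + 2 * u (logPolar t s) = 2 * t + (2 * t + 2 * u (logPolar t s)) by ring,
      exp_add, exp_add, mul_left_comm, ← mul_assoc c]
    have := hlow t s ((le_max_left _ _).trans ht) hs
    gcongr
  · intro t ht
    have h1 := hpoh t ((le_max_right _ _).trans ht)
    have c1 : Continuous fun s => fderiv ℝ u (logPolar t s) (logPolar t s) :=
      H.cont_t.comp (Continuous.prodMk_right t)
    have c2 : Continuous fun s => fderiv ℝ u (logPolar t s) (logPolarTangent t s) :=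
      H.cont_s.comp (Continuous.prodMk_right t)
    have c3 : Continuous fun s =>
        exp (2 * t) * (evalPoly p (logPolar t s) * exp (2 * u (logPolar t s))) :=
      H.cont_h.comp (Continuous.prodMk_right t)
    have i1 := (c1.pow 2).intervalIntegrable (μ := volume) (-π) π
    have i2 := (c2.pow 2).intervalIntegrable (μ := volume) (-π) π
    have i3 := c3.intervalIntegrable (μ := volume) (-π) π
    simp only [Pi.pow_def] at i1 i2
    have h2 := sq_integral_circle_le c1
    simp only [pohozaev] at h1
    rw [intervalIntegral.integral_div, intervalIntegral.integral_add (i1.sub i2) i3,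
      intervalIntegral.integral_sub i1 i2] at h1
    have h3 : (∫ s in (-π)..π, fderiv ℝ u (logPolar t s) (logPolar t s)) ^ 2 / (4 * π)
        ≤ (∫ s in (-π)..π, fderiv ℝ u (logPolar t s) (logPolar t s) ^ 2) / 2 := by
      rw [div_le_div_iff₀ (by positivity) two_pos]
      linarith
    linarith
end

section
/- Let m ≥ 1 be an integer and let h : ℝ^n → ℝ be a smooth function with Δ^m h = 0 on ℝ^n. If there exist constants C > 0 and l ≥ 0 such that h(x) ≤ C(1 + |x|^l) for all x ∈ ℝ^n, then h is a polynomial of degree at most max{l, 2m − 2}. -/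
open MeasureTheory Metric Real MvPolynomial

/-- The `m`-fold iterate `Δ^m u` of the Laplacian. -/
noncomputable def lapIter {n : ℕ} (m : ℕ) (u : EuclideanSpace ℝ (Fin n) → ℝ) :
    EuclideanSpace ℝ (Fin n) → ℝ :=
  (fun v x => lap v x)^[m] u

section DirectionalDerivative

variable {n : ℕ}

/-- The derivative of `u` in the direction `v`. -/
noncomputable def dirDeriv (v : EuclideanSpace ℝ (Fin n)) (u : EuclideanSpace ℝ (Fin n) → ℝ)
    (x : EuclideanSpace ℝ (Fin n)) : ℝ :=
  fderiv ℝ u x v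

theorem ContDiff.dirDeriv {u : EuclideanSpace ℝ (Fin n) → ℝ} (hu : ContDiff ℝ (⊤ : ℕ∞) u)
    (v : EuclideanSpace ℝ (Fin n)) : ContDiff ℝ (⊤ : ℕ∞) (dirDeriv v u) :=
  (hu.fderiv_right (m := (⊤ : ℕ∞)) (by simp)).clm_apply contDiff_const

theorem dirDeriv_comm {u : EuclideanSpace ℝ (Fin n) → ℝ} (hu : ContDiff ℝ (⊤ : ℕ∞) u)
    (v w : EuclideanSpace ℝ (Fin n)) : dirDeriv v (dirDeriv w u) = dirDeriv w (dirDeriv v u) := by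
  ext x
  have hd : DifferentiableAt ℝ (fderiv ℝ u) x :=
    (hu.fderiv_right (m := (⊤ : ℕ∞)) (by simp)).differentiable (by simp) x
  have key (a b : EuclideanSpace ℝ (Fin n)) :
      dirDeriv a (dirDeriv b u) x = fderiv ℝ (fderiv ℝ u) x a b := by
    unfold dirDeriv
    rw [fderiv_clm_apply hd (differentiableAt_const b)]
    simp
  rw [key, key]
  exact (hu.contDiffAt.isSymmSndFDerivAt
    (by simpa using WithTop.coe_le_coe.2 (le_top : (2 : ℕ∞) ≤ ⊤))).eq v w

theorem lap_eq_sum_dirDeriv {u : EuclideanSpace ℝ (Fin n) → ℝ} (hu : ContDiff ℝ (⊤ : ℕ∞) u) :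
    lap u = fun x => ∑ i : Fin n, dirDeriv (EuclideanSpace.single i 1)
      (dirDeriv (EuclideanSpace.single i 1) u) x := by
  ext x
  have hd : DifferentiableAt ℝ (fderiv ℝ u) x :=
    (hu.fderiv_right (m := (⊤ : ℕ∞)) (by simp)).differentiable (by simp) x
  refine Finset.sum_congr rfl fun i _ => ?_
  rw [iteratedFDeriv_two_apply]
  unfold dirDeriv
  rw [fderiv_clm_apply hd (differentiableAt_const _)]
  simp

theorem ContDiff.lap {u : EuclideanSpace ℝ (Fin n) → ℝ} (hu : ContDiff ℝ (⊤ : ℕ∞) u) :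
    ContDiff ℝ (⊤ : ℕ∞) (lap u) := by
  rw [lap_eq_sum_dirDeriv hu]
  exact ContDiff.sum fun i _ => (hu.dirDeriv _).dirDeriv _

theorem dirDeriv_lap {u : EuclideanSpace ℝ (Fin n) → ℝ} (hu : ContDiff ℝ (⊤ : ℕ∞) u)
    (v : EuclideanSpace ℝ (Fin n)) : dirDeriv v (lap u) = lap (dirDeriv v u) := by
  ext x
  rw [lap_eq_sum_dirDeriv hu, lap_eq_sum_dirDeriv (hu.dirDeriv v)]
  have : dirDeriv v (fun x => ∑ i : Fin n, dirDeriv (EuclideanSpace.single i 1)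
      (dirDeriv (EuclideanSpace.single i 1) u) x) x = ∑ i : Fin n, dirDeriv v
      (dirDeriv (EuclideanSpace.single i 1) (dirDeriv (EuclideanSpace.single i 1) u)) x := by
    rw [dirDeriv, fderiv_fun_sum fun i _ =>
      (((hu.dirDeriv _).dirDeriv _).differentiable (by simp) x)]
    simp [dirDeriv]
  rw [this]
  refine Finset.sum_congr rfl fun i _ => ?_
  rw [dirDeriv_comm (hu.dirDeriv _) v, dirDeriv_comm hu v]

theorem lapIter_succ (m : ℕ) (u : EuclideanSpace ℝ (Fin n) → ℝ) :
    lapIter (m + 1) u = lapIter m (lap u) :=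
  rfl

theorem dirDeriv_lapIter (m : ℕ) {u : EuclideanSpace ℝ (Fin n) → ℝ} (hu : ContDiff ℝ (⊤ : ℕ∞) u)
    (v : EuclideanSpace ℝ (Fin n)) : dirDeriv v (lapIter m u) = lapIter m (dirDeriv v u) := by
  induction m generalizing u with
  | zero => rfl
  | succ m ih => rw [lapIter_succ, lapIter_succ, ih hu.lap, dirDeriv_lap hu]

theorem lapIter_dirDeriv_eq_zero {m : ℕ} {u : EuclideanSpace ℝ (Fin n) → ℝ}
    (hu : ContDiff ℝ (⊤ : ℕ∞) u) (hm : ∀ x, lapIter m u x = 0) (v : EuclideanSpace ℝ (Fin n))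
    (x : EuclideanSpace ℝ (Fin n)) : lapIter m (dirDeriv v u) x = 0 := by
  rw [← dirDeriv_lapIter m hu, show lapIter m u = fun _ => 0 from funext hm]
  simp [dirDeriv]

theorem fderiv_apply_eq_sum (u : EuclideanSpace ℝ (Fin n) → ℝ) (x y : EuclideanSpace ℝ (Fin n)) :
    fderiv ℝ u x y = ∑ i : Fin n, y i * dirDeriv (EuclideanSpace.single i 1) u x := by
  have hy : y = ∑ i : Fin n, y i • EuclideanSpace.single i (1 : ℝ) := by
    ext j
    simp [Finset.sum_apply, Pi.single_apply]
  conv_lhs => rw [hy]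
  simp [dirDeriv]

/-- Differentiation along a line, for the function `r ↦ u (x + r y)`. -/
theorem hasDerivAt_comp_line {u : EuclideanSpace ℝ (Fin n) → ℝ} (hu : ContDiff ℝ (⊤ : ℕ∞) u)
    (x y : EuclideanSpace ℝ (Fin n)) (r : ℝ) :
    HasDerivAt (fun r : ℝ => u (x + r • y)) (fderiv ℝ u (x + r • y) y) r := by
  have h1 : HasDerivAt (fun r : ℝ => x + r • y) y r := by
    simpa using ((hasDerivAt_id r).smul_const y).const_add x
  exact ((hu.differentiable (by simp) (x + r • y)).hasFDerivAt).comp_hasDerivAt r h1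

/-- Differentiation of a translated dilate. -/
theorem dirDeriv_comp_affine {u : EuclideanSpace ℝ (Fin n) → ℝ} (hu : ContDiff ℝ (⊤ : ℕ∞) u)
    (x v : EuclideanSpace ℝ (Fin n)) (r : ℝ) (y : EuclideanSpace ℝ (Fin n)) :
    fderiv ℝ (fun y => u (x + r • y)) y v = r * dirDeriv v u (x + r • y) := by
  have h1 : HasFDerivAt (fun y : EuclideanSpace ℝ (Fin n) => x + r • y)
      (r • ContinuousLinearMap.id ℝ (EuclideanSpace ℝ (Fin n))) y :=
    ((hasFDerivAt_id y).const_smul r).const_add x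
  have h2 := ((hu.differentiable (by simp) (x + r • y)).hasFDerivAt).comp y h1
  have h3 : fderiv ℝ (fun y => u (x + r • y)) y = _ := h2.fderiv
  rw [h3]
  simp [dirDeriv]

end DirectionalDerivative

section RadialMean

variable {n : ℕ}

/-- The integral of `u (x + r y)` against the radial weight `g (|y|²)`. -/
noncomputable def radialMean (g : ℝ → ℝ) (u : EuclideanSpace ℝ (Fin n) → ℝ)
    (x : EuclideanSpace ℝ (Fin n)) (r : ℝ) : ℝ :=
  ∫ y, u (x + r • y) * g (‖y‖ ^ 2)

theorem hasCompactSupport_radial {g : ℝ → ℝ} (hg : ∀ s, 1 ≤ s → g s = 0) :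
    HasCompactSupport (fun y : EuclideanSpace ℝ (Fin n) => g (‖y‖ ^ 2)) := by
  refine HasCompactSupport.of_support_subset_isCompact (isCompact_closedBall 0 1) fun y hy => ?_
  by_contra hy'
  refine hy (hg _ ?_)
  have : 1 < ‖y‖ := by simpa using hy'
  nlinarith

theorem contDiff_radial {g : ℝ → ℝ} (hg : ContDiff ℝ (⊤ : ℕ∞) g) :
    ContDiff ℝ (⊤ : ℕ∞) (fun y : EuclideanSpace ℝ (Fin n) => g (‖y‖ ^ 2)) :=
  hg.comp (contDiff_norm_sq ℝ)

theorem integrable_mul_of_hasCompactSupport {f φ : EuclideanSpace ℝ (Fin n) → ℝ}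
    (hf : Continuous f) (hφ : Continuous φ) (hc : HasCompactSupport φ) :
    Integrable (fun y => f y * φ y) :=
  (hf.mul hφ).integrable_of_hasCompactSupport hc.mul_left

theorem integral_dirDeriv_mul {u φ : EuclideanSpace ℝ (Fin n) → ℝ}
    (hu : ContDiff ℝ (⊤ : ℕ∞) u) (hφ : ContDiff ℝ (⊤ : ℕ∞) φ) (hc : HasCompactSupport φ)
    (v x : EuclideanSpace ℝ (Fin n)) (r : ℝ) :
    ∫ y, u (x + r • y) * dirDeriv v φ y = -(r * ∫ y, dirDeriv v u (x + r • y) * φ y) := by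
  have hcu : Continuous fun y : EuclideanSpace ℝ (Fin n) => u (x + r • y) :=
    hu.continuous.comp (by fun_prop)
  have hcd : Continuous fun y : EuclideanSpace ℝ (Fin n) => dirDeriv v u (x + r • y) :=
    (hu.dirDeriv v).continuous.comp (by fun_prop)
  have hcs : HasCompactSupport (dirDeriv v φ) := hc.fderiv_apply (𝕜 := ℝ) v
  have h := integral_mul_fderiv_eq_neg_fderiv_mul_of_integrable (𝕜 := ℝ) (μ := volume)
    (f := fun y => u (x + r • y)) (g := φ) (v := v) ?_ ?_ ?_ ?_ ?_
  · simp only [dirDeriv_comp_affine hu, mul_assoc, integral_const_mul] at h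
    exact h
  · simp only [dirDeriv_comp_affine hu]
    exact integrable_mul_of_hasCompactSupport (continuous_const.mul hcd) hφ.continuous hc
  · exact integrable_mul_of_hasCompactSupport hcu (hφ.dirDeriv v).continuous hcs
  · exact integrable_mul_of_hasCompactSupport hcu hφ.continuous hc
  · intro y _
    exact (hu.differentiable (by simp)).comp
      ((differentiable_id.const_smul r).const_add x) y
  · intro y _
    exact hφ.differentiable (by simp) y

theorem exists_radial_primitive {g : ℝ → ℝ} (hg : ContDiff ℝ (⊤ : ℕ∞) g)
    (hg1 : ∀ s, 1 ≤ s → g s = 0) :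
    ∃ G : ℝ → ℝ, ContDiff ℝ (⊤ : ℕ∞) G ∧ (∀ s, 1 ≤ s → G s = 0) ∧
      ∀ s, HasDerivAt G (g s / 2) s := by
  have hd (s : ℝ) : HasDerivAt (fun s => ∫ t in (1 : ℝ)..s, g t / 2) (g s / 2) s :=
    have hc : Continuous fun t => g t / 2 := hg.continuous.div_const 2
    intervalIntegral.integral_hasDerivAt_right (hc.intervalIntegrable _ _)
      (hc.stronglyMeasurableAtFilter _ _) hc.continuousAt
  refine ⟨_, contDiff_infty_iff_deriv.2 ⟨fun s => (hd s).differentiableAt, ?_⟩, ?_, hd⟩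
  · rw [show deriv _ = fun s => g s / 2 from funext fun s => (hd s).deriv]
    exact hg.div_const 2
  · intro s hs
    rw [intervalIntegral.integral_congr (g := fun _ => (0 : ℝ))]
    · simp
    · intro t ht
      rw [Set.uIcc_of_le hs] at ht
      simp [hg1 t ht.1]

theorem dirDeriv_radial {g G : ℝ → ℝ} (hG : ∀ s, HasDerivAt G (g s / 2) s) (i : Fin n)
    (y : EuclideanSpace ℝ (Fin n)) :
    dirDeriv (EuclideanSpace.single i 1) (fun y => G (‖y‖ ^ 2)) y = y i * g (‖y‖ ^ 2) := by
  have h := (hG (‖y‖ ^ 2)).comp_hasFDerivAt y (hasStrictFDerivAt_norm_sq y).hasFDerivAt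
  have h' : fderiv ℝ (fun y : EuclideanSpace ℝ (Fin n) => G (‖y‖ ^ 2)) y = _ := h.fderiv
  unfold dirDeriv
  rw [h']
  simp [EuclideanSpace.inner_single_right]
  ring

theorem hasDerivAt_integral_comp_line {u φ : EuclideanSpace ℝ (Fin n) → ℝ}
    (hu : ContDiff ℝ (⊤ : ℕ∞) u) (hφ : Continuous φ) (hc : HasCompactSupport φ)
    (x : EuclideanSpace ℝ (Fin n)) (r : ℝ) :
    HasDerivAt (fun r : ℝ => ∫ y, u (x + r • y) * φ y)
      (∫ y, fderiv ℝ u (x + r • y) y * φ y) r := by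
  have hcu (r : ℝ) : Continuous fun y : EuclideanSpace ℝ (Fin n) => u (x + r • y) :=
    hu.continuous.comp (by fun_prop)
  have hcd : Continuous fun p : ℝ × EuclideanSpace ℝ (Fin n) =>
      fderiv ℝ u (x + p.1 • p.2) p.2 := by
    have h1 : Continuous (fderiv ℝ u) := hu.continuous_fderiv (by simp)
    exact (h1.comp (by fun_prop)).clm_apply continuous_snd
  have hcd' (r : ℝ) : Continuous fun y : EuclideanSpace ℝ (Fin n) => fderiv ℝ u (x + r • y) y :=
    hcd.comp (by fun_prop : Continuous fun y : EuclideanSpace ℝ (Fin n) => (r, y))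
  obtain ⟨B, hB⟩ := ((isCompact_closedBall r 1).prod hc).exists_bound_of_continuousOn
    hcd.continuousOn
  refine (hasDerivAt_integral_of_dominated_loc_of_deriv_le (closedBall_mem_nhds r one_pos)
    (bound := fun y => B * ‖φ y‖)
    (.of_forall fun r => ((hcu r).mul hφ).aestronglyMeasurable)
    (integrable_mul_of_hasCompactSupport (hcu r) hφ hc)
    ((hcd' r).mul hφ).aestronglyMeasurable (.of_forall fun y s hs => ?_)
    ((hφ.integrable_of_hasCompactSupport hc).norm.const_mul B)
    (.of_forall fun y s _ => (hasDerivAt_comp_line hu x y s).mul_const (φ y))).2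
  by_cases hy : y ∈ tsupport φ
  · rw [norm_mul]
    exact mul_le_mul_of_nonneg_right (hB (s, y) ⟨hs, hy⟩) (norm_nonneg _)
  · simp [image_eq_zero_of_notMem_tsupport hy]

theorem hasDerivAt_radialMean {g G : ℝ → ℝ} (hg : ContDiff ℝ (⊤ : ℕ∞) g)
    (hg1 : ∀ s, 1 ≤ s → g s = 0) (hG : ContDiff ℝ (⊤ : ℕ∞) G) (hG1 : ∀ s, 1 ≤ s → G s = 0)
    (hGg : ∀ s, HasDerivAt G (g s / 2) s) {u : EuclideanSpace ℝ (Fin n) → ℝ}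
    (hu : ContDiff ℝ (⊤ : ℕ∞) u) (x : EuclideanSpace ℝ (Fin n)) (r : ℝ) :
    HasDerivAt (radialMean g u x) (-(r * radialMean G (lap u) x r)) r := by
  refine (hasDerivAt_integral_comp_line hu (contDiff_radial hg).continuous
    (hasCompactSupport_radial hg1) x r).congr_deriv (Eq.symm ?_)
  have hcs := hasCompactSupport_radial (n := n) hG1
  have hintegrable (f : EuclideanSpace ℝ (Fin n) → ℝ) (hf : ContDiff ℝ (⊤ : ℕ∞) f) (i : Fin n) :
      Integrable fun y => f (x + r • y) *
        dirDeriv (EuclideanSpace.single i 1) (fun y => G (‖y‖ ^ 2)) y :=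
    integrable_mul_of_hasCompactSupport (hf.continuous.comp (by fun_prop))
      ((contDiff_radial hG).dirDeriv _).continuous (hcs.fderiv_apply (𝕜 := ℝ) _)
  calc -(r * radialMean G (lap u) x r)
      = ∑ i : Fin n, -(r * ∫ y, dirDeriv (EuclideanSpace.single i 1)
          (dirDeriv (EuclideanSpace.single i 1) u) (x + r • y) * G (‖y‖ ^ 2)) := by
        rw [radialMean, lap_eq_sum_dirDeriv hu]
        simp only [Finset.sum_mul]
        rw [integral_finsetSum, Finset.mul_sum, Finset.sum_neg_distrib]
        exact fun i _ => integrable_mul_of_hasCompactSupport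
          (((hu.dirDeriv _).dirDeriv _).continuous.comp (by fun_prop))
          (contDiff_radial hG).continuous hcs
    _ = ∑ i : Fin n, ∫ y, dirDeriv (EuclideanSpace.single i 1) u (x + r • y) *
          dirDeriv (EuclideanSpace.single i 1) (fun y => G (‖y‖ ^ 2)) y := by
        refine Finset.sum_congr rfl fun i _ => ?_
        rw [integral_dirDeriv_mul (hu.dirDeriv _) (contDiff_radial hG) hcs]
    _ = ∫ y, fderiv ℝ u (x + r • y) y * g (‖y‖ ^ 2) := by
        rw [← integral_finsetSum _ fun i _ => hintegrable _ (hu.dirDeriv _) i]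
        refine integral_congr_ae (.of_forall fun y => ?_)
        simp only [dirDeriv_radial hGg, fderiv_apply_eq_sum u (x + r • y) y, Finset.sum_mul]
        exact Finset.sum_congr rfl fun i _ => by ring

theorem exists_polynomial_antideriv {m : ℕ} (Q : Polynomial ℝ) (hQ : Q.degree < m) (c : ℝ) :
    ∃ P : Polynomial ℝ, P.degree < (m + 1 : ℕ) ∧ P.eval 0 = c ∧ P.derivative = Q := by
  refine ⟨Polynomial.C c + ∑ j ∈ Finset.range m,
    Polynomial.monomial (j + 1) (Q.coeff j / (j + 1)), ?_, ?_, ?_⟩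
  · refine (Polynomial.degree_add_le _ _).trans_lt (max_lt ?_ ?_)
    · exact Polynomial.degree_C_le.trans_lt (by exact_mod_cast Nat.succ_pos m)
    · refine (Polynomial.degree_sum_le _ _).trans_lt
        ((Finset.sup_lt_iff (by exact WithBot.bot_lt_coe _)).2 fun j hj => ?_)
      refine (Polynomial.degree_monomial_le _ _).trans_lt ?_
      have := Finset.mem_range.1 hj
      exact_mod_cast Nat.succ_lt_succ this
  · simp [Polynomial.eval_finsetSum]
  · have hQ' : ∑ j ∈ Finset.range m, Polynomial.monomial j (Q.coeff j) = Q := by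
      ext k
      simp only [Polynomial.finsetSum_coeff, Polynomial.coeff_monomial]
      rw [Finset.sum_ite_eq']
      split_ifs with h
      · rfl
      · exact (Polynomial.coeff_eq_zero_of_degree_lt
          (hQ.trans_le (by exact_mod_cast not_lt.1 (mt Finset.mem_range.2 h)))).symm
    conv_rhs => rw [← hQ']
    simp only [Polynomial.derivative_add, Polynomial.derivative_C, zero_add,
      Polynomial.derivative_sum, Polynomial.derivative_monomial]
    refine Finset.sum_congr rfl fun j _ => ?_
    have : (j : ℝ) + 1 ≠ 0 := by positivity
    simp [div_mul_cancel₀ _ this]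

/-- Radial means of an `m`-polyharmonic function are polynomials in the squared radius. -/
theorem exists_polynomial_radialMean (m : ℕ) {g : ℝ → ℝ} (hg : ContDiff ℝ (⊤ : ℕ∞) g)
    (hg1 : ∀ s, 1 ≤ s → g s = 0) {u : EuclideanSpace ℝ (Fin n) → ℝ}
    (hu : ContDiff ℝ (⊤ : ℕ∞) u) (hm : ∀ x, lapIter m u x = 0) (x : EuclideanSpace ℝ (Fin n)) :
    ∃ P : Polynomial ℝ, P.degree < m ∧ ∀ r, radialMean g u x r = P.eval (r ^ 2) := by
  induction m generalizing g u with
  | zero =>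
    refine ⟨0, by simp, fun r => ?_⟩
    have h0 : ∀ x, u x = 0 := hm
    simp [radialMean, h0]
  | succ m ih =>
    obtain ⟨G, hG, hG1, hGg⟩ := exists_radial_primitive hg hg1
    obtain ⟨Q, hQ, hQF⟩ := ih hG hG1 hu.lap hm
    obtain ⟨P, hP, hP0, hPQ⟩ := exists_polynomial_antideriv (Polynomial.C (-1 / 2) * Q)
      ((Polynomial.degree_C_mul (by norm_num)).trans_lt hQ) (radialMean g u x 0)
    refine ⟨P, hP, fun r => ?_⟩
    have hd (r : ℝ) : HasDerivAt (fun r => radialMean g u x r - P.eval (r ^ 2)) 0 r := by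
      have h1 := hasDerivAt_radialMean hg hg1 hG hG1 hGg hu x r
      have h2 := (P.hasDerivAt (r ^ 2)).comp r (hasDerivAt_pow 2 r)
      refine (h1.sub h2).congr_deriv ?_
      rw [hPQ, hQF]
      simp
      ring
    have := is_const_of_deriv_eq_zero (fun r => (hd r).differentiableAt)
      (fun r => (hd r).deriv) r 0
    simp [hP0] at this
    linarith

end RadialMean

section MeanValue

variable {n : ℕ}

theorem exists_extrapolation_weights (m : ℕ) :
    ∃ c : ℕ → ℝ, ∀ P : Polynomial ℝ, P.degree < m → ∀ R : ℝ,
      P.eval 0 = ∑ k ∈ Finset.range m, c k * P.eval ((((k : ℝ) + 1) * R) ^ 2) := by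
  have hinj : Set.InjOn (fun k : ℕ => ((k : ℝ) + 1) ^ 2) (Finset.range m) := by
    intro a _ b _ hab
    have : (a : ℝ) + 1 = b + 1 := (sq_eq_sq₀ (by positivity) (by positivity)).1 hab
    exact_mod_cast add_right_cancel this
  refine ⟨fun k => (Lagrange.basis (Finset.range m) (fun k : ℕ => ((k : ℝ) + 1) ^ 2) k).eval 0,
    fun P hP R => ?_⟩
  have hdeg : (P.comp (Polynomial.C (R ^ 2) * Polynomial.X)).degree <
      (Finset.range m).card := by
    rw [Finset.card_range, Polynomial.degree_lt_iff_coeff_zero]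
    intro j hj
    rw [Polynomial.comp_C_mul_X_coeff,
      Polynomial.coeff_eq_zero_of_degree_lt (hP.trans_le (by exact_mod_cast hj)), zero_mul]
  have h := congrArg (Polynomial.eval 0) (Lagrange.eq_interpolate hinj hdeg)
  rw [Lagrange.interpolate_apply, Polynomial.eval_finsetSum] at h
  simp only [Polynomial.eval_comp, Polynomial.eval_mul, Polynomial.eval_C, Polynomial.eval_X,
    mul_zero] at h
  rw [h]
  exact Finset.sum_congr rfl fun k _ => by rw [mul_comm, mul_pow, mul_comm (R ^ 2)]

theorem exists_reproducing_weights (m : ℕ) {g : ℝ → ℝ} (hg : ContDiff ℝ (⊤ : ℕ∞) g)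
    (hg1 : ∀ s, 1 ≤ s → g s = 0) :
    ∃ c : ℕ → ℝ, ∀ u : EuclideanSpace ℝ (Fin n) → ℝ, ContDiff ℝ (⊤ : ℕ∞) u →
      (∀ x, lapIter m u x = 0) → ∀ x R,
        u x * ∫ y : EuclideanSpace ℝ (Fin n), g (‖y‖ ^ 2) =
          ∑ k ∈ Finset.range m, c k * radialMean g u x (((k : ℝ) + 1) * R) := by
  obtain ⟨c, hc⟩ := exists_extrapolation_weights m
  refine ⟨c, fun u hu hm x R => ?_⟩
  obtain ⟨P, hP, hPF⟩ := exists_polynomial_radialMean m hg hg1 hu hm x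
  simp only [hPF]
  rw [← hc P hP R]
  have := hPF 0
  simpa [radialMean, integral_const_mul] using this

/-- A smooth cutoff profile: it equals `1` up to `1 / 2` and vanishes from `1` on. -/
noncomputable def cutoff (s : ℝ) : ℝ :=
  smoothTransition (2 - 2 * s)

theorem contDiff_cutoff : ContDiff ℝ (⊤ : ℕ∞) cutoff :=
  Real.smoothTransition.contDiff.comp (by fun_prop)

theorem cutoff_nonneg (s : ℝ) : 0 ≤ cutoff s :=
  Real.smoothTransition.nonneg _

theorem cutoff_eq_zero (s : ℝ) (hs : 1 ≤ s) : cutoff s = 0 :=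
  Real.smoothTransition.zero_of_nonpos (by linarith)

theorem cutoff_eq_one {s : ℝ} (hs : s ≤ 1 / 2) : cutoff s = 1 :=
  Real.smoothTransition.one_of_one_le (by linarith)

theorem integrable_mul_cutoff {f : EuclideanSpace ℝ (Fin n) → ℝ} (hf : Continuous f) :
    Integrable fun y => f y * cutoff (‖y‖ ^ 2) :=
  integrable_mul_of_hasCompactSupport hf (contDiff_radial contDiff_cutoff).continuous
    (hasCompactSupport_radial cutoff_eq_zero)

theorem integrable_cutoff :
    Integrable fun y : EuclideanSpace ℝ (Fin n) => cutoff (‖y‖ ^ 2) :=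
  (contDiff_radial contDiff_cutoff).continuous.integrable_of_hasCompactSupport
    (hasCompactSupport_radial cutoff_eq_zero)

theorem integral_cutoff_pos : 0 < ∫ y : EuclideanSpace ℝ (Fin n), cutoff (‖y‖ ^ 2) :=
  (contDiff_radial contDiff_cutoff).continuous.integral_pos_of_hasCompactSupport_nonneg_nonzero
    (hasCompactSupport_radial cutoff_eq_zero) (fun _ => cutoff_nonneg _) (x := 0)
    (by simp [cutoff_eq_one])

theorem tsupport_cutoff_subset :
    tsupport (fun y : EuclideanSpace ℝ (Fin n) => cutoff (‖y‖ ^ 2)) ⊆ closedBall 0 1 := by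
  refine closure_minimal (fun y hy => ?_) isClosed_closedBall
  by_contra hy'
  refine hy (cutoff_eq_zero _ ?_)
  have : 1 < ‖y‖ := by simpa using hy'
  nlinarith

/-- Polynomial growth of an `m`-polyharmonic function improves by one under differentiation. -/
theorem exists_dirDeriv_bound {m : ℕ} {u : EuclideanSpace ℝ (Fin n) → ℝ}
    (hu : ContDiff ℝ (⊤ : ℕ∞) u) (hm : ∀ x, lapIter m u x = 0) {A L : ℝ} (hL : 0 ≤ L)
    (hA : ∀ x, |u x| ≤ A * (1 + ‖x‖) ^ L) (v : EuclideanSpace ℝ (Fin n)) :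
    ∃ K, ∀ x R, 1 + ‖x‖ ≤ R → |dirDeriv v u x| ≤ K * R ^ (L - 1) := by
  obtain ⟨c, hc⟩ := exists_reproducing_weights (n := n) m contDiff_cutoff cutoff_eq_zero
  have hM := integral_cutoff_pos (n := n)
  set M := ∫ y : EuclideanSpace ℝ (Fin n), cutoff (‖y‖ ^ 2)
  have hA0 : 0 ≤ A := by simpa using (abs_nonneg _).trans (hA 0)
  set φ : EuclideanSpace ℝ (Fin n) → ℝ := fun y => cutoff (‖y‖ ^ 2)
  have hφs : ContDiff ℝ (⊤ : ℕ∞) φ := contDiff_radial contDiff_cutoff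
  have hφc : HasCompactSupport φ := hasCompactSupport_radial cutoff_eq_zero
  set D := A * ((m : ℝ) + 1) ^ L * ∫ y, |dirDeriv v φ y|
  have hD : 0 ≤ D := by positivity
  refine ⟨M⁻¹ * ((∑ k ∈ Finset.range m, |c k|) * D), fun x R hR => ?_⟩
  have hR1 : 1 ≤ R := by linarith [norm_nonneg x]
  have hR0 : 0 < R := by linarith
  have hmean (k : ℕ) (hk : k ∈ Finset.range m) :
      |radialMean cutoff (dirDeriv v u) x (((k : ℝ) + 1) * R)| ≤ D * R ^ (L - 1) := by
    set s := ((k : ℝ) + 1) * R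
    have hsR : R ≤ s := by nlinarith [(Nat.cast_nonneg k : (0 : ℝ) ≤ k)]
    have hkm : (k : ℝ) + 1 ≤ m := by exact_mod_cast Finset.mem_range.1 hk
    have hsm : s ≤ m * R := mul_le_mul_of_nonneg_right hkm hR0.le
    have hibp := integral_dirDeriv_mul hu hφs hφc v x s
    have hpt (y : EuclideanSpace ℝ (Fin n)) : ‖u (x + s • y) * dirDeriv v φ y‖ ≤
        A * (((m : ℝ) + 1) * R) ^ L * |dirDeriv v φ y| := by
      rw [norm_mul, Real.norm_eq_abs, Real.norm_eq_abs]
      by_cases hy : y ∈ closedBall (0 : EuclideanSpace ℝ (Fin n)) 1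
      · refine mul_le_mul_of_nonneg_right ((hA _).trans ?_) (abs_nonneg _)
        refine mul_le_mul_of_nonneg_left (Real.rpow_le_rpow (by positivity) ?_ hL) hA0
        have h1 : ‖y‖ ≤ 1 := by simpa using hy
        have h2 : ‖x + s • y‖ ≤ ‖x‖ + s * ‖y‖ := by
          refine (norm_add_le _ _).trans ?_
          rw [norm_smul, Real.norm_of_nonneg (by linarith)]
        nlinarith
      · have : fderiv ℝ φ y = 0 := by
          refine image_eq_zero_of_notMem_tsupport fun h => hy ?_
          exact tsupport_cutoff_subset (tsupport_fderiv_subset ℝ h)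
        simp [dirDeriv, this]
    have hintegrable : Integrable fun y => |dirDeriv v φ y| :=
      ((hφs.dirDeriv v).continuous.integrable_of_hasCompactSupport
        (hφc.fderiv_apply (𝕜 := ℝ) v)).abs
    have hbd := norm_integral_le_of_norm_le (hintegrable.const_mul _) (.of_forall hpt)
    rw [hibp, integral_const_mul, norm_neg, norm_mul, Real.norm_eq_abs, Real.norm_eq_abs,
      abs_of_pos (by linarith : 0 < s), Real.mul_rpow (by positivity) hR0.le] at hbd
    rw [Real.rpow_sub_one hR0.ne', mul_div_assoc', le_div_iff₀ hR0]
    calc |radialMean cutoff (dirDeriv v u) x s| * R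
        ≤ s * |radialMean cutoff (dirDeriv v u) x s| := by
          rw [mul_comm]
          exact mul_le_mul_of_nonneg_right hsR (abs_nonneg _)
      _ ≤ _ := hbd
      _ = D * R ^ L := by ring
  have hrep := hc _ (hu.dirDeriv v) (lapIter_dirDeriv_eq_zero hu hm v) x R
  rw [mul_assoc, inv_mul_eq_div, le_div_iff₀ hM, ← abs_of_pos hM, ← abs_mul, hrep]
  refine (Finset.abs_sum_le_sum_abs _ _).trans ?_
  rw [mul_assoc, Finset.sum_mul]
  refine Finset.sum_le_sum fun k hk => ?_
  rw [abs_mul]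
  exact mul_le_mul_of_nonneg_left (hmean k hk) (abs_nonneg _)

theorem integral_comp_affine_mul_cutoff_le {f : EuclideanSpace ℝ (Fin n) → ℝ}
    (hf : Continuous f) (hf0 : ∀ x, 0 ≤ f x) {s : ℝ} (hs : 0 < s)
    {x : EuclideanSpace ℝ (Fin n)} (hx : ‖x‖ ≤ s) :
    radialMean cutoff f x s ≤ 4 ^ n * radialMean cutoff f 0 (4 * s) := by
  set v := s⁻¹ • x with hv
  have hv1 : ‖v‖ ≤ 1 := by
    rw [hv, norm_smul, norm_inv, Real.norm_of_nonneg hs.le, inv_mul_le_iff₀ hs]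
    simpa using hx
  have hsv : s • v = x := by rw [hv, smul_inv_smul₀ hs.ne']
  have hchange : radialMean cutoff f x s = 4 ^ n * ∫ z : EuclideanSpace ℝ (Fin n),
      f (x + s • ((4 : ℝ) • z - v)) * cutoff (‖(4 : ℝ) • z - v‖ ^ 2) := by
    rw [Measure.integral_comp_smul volume
      (fun z => f (x + s • (z - v)) * cutoff (‖z - v‖ ^ 2)) 4,
      integral_sub_right_eq_self (fun z => f (x + s • z) * cutoff (‖z‖ ^ 2)) v]
    simp [radialMean]
  rw [hchange]
  refine mul_le_mul_of_nonneg_left (integral_mono_of_nonneg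
    (.of_forall fun z => mul_nonneg (hf0 _) (cutoff_nonneg _))
    (integrable_mul_cutoff (hf.comp (by fun_prop))) (.of_forall fun z => ?_)) (by positivity)
  have harg : x + s • ((4 : ℝ) • z - v) = 0 + (4 * s) • z := by
    rw [smul_sub, hsv, smul_smul, mul_comm s]
    abel
  simp only [harg]
  refine mul_le_mul_of_nonneg_left ?_ (hf0 _)
  by_cases hz : 1 ≤ ‖(4 : ℝ) • z - v‖ ^ 2
  · rw [cutoff_eq_zero _ hz]
    exact cutoff_nonneg _
  · have h1 : ‖(4 : ℝ) • z - v‖ < 1 := by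
      by_contra h
      exact hz (one_le_pow₀ (not_lt.1 h))
    have h2 : ‖(4 : ℝ) • z‖ ≤ ‖(4 : ℝ) • z - v‖ + ‖v‖ := by
      simpa using norm_add_le ((4 : ℝ) • z - v) v
    rw [norm_smul, Real.norm_of_nonneg (by norm_num)] at h2
    have h3 : ‖z‖ ≤ 1 / 2 := by linarith
    rw [cutoff_eq_one (s := ‖z‖ ^ 2) (by nlinarith [norm_nonneg z])]
    exact Real.smoothTransition.le_one _

theorem exists_abs_eval_sq_le {m : ℕ} (hm : 1 ≤ m) (P : Polynomial ℝ) (hP : P.degree < m) :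
    ∃ B, 0 ≤ B ∧ ∀ r L : ℝ, 0 ≤ r → 2 * (m : ℝ) - 2 ≤ L →
      |P.eval (r ^ 2)| ≤ B * (1 + r) ^ L := by
  have hnat : P.natDegree < m := by
    by_cases h : P = 0
    · simpa [h] using Nat.lt_of_succ_le hm
    · exact (Polynomial.natDegree_lt_iff_degree_lt h).2 hP
  refine ⟨∑ j ∈ Finset.range m, |P.coeff j|, by positivity, fun r L hr hL => ?_⟩
  rw [Polynomial.eval_eq_sum_range' hnat, Finset.sum_mul]
  refine (Finset.abs_sum_le_sum_abs _ _).trans (Finset.sum_le_sum fun j hj => ?_)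
  rw [abs_mul]
  refine mul_le_mul_of_nonneg_left ?_ (abs_nonneg _)
  have hjm : (j : ℝ) + 1 ≤ m := by exact_mod_cast Finset.mem_range.1 hj
  rw [abs_of_nonneg (by positivity), ← pow_mul]
  calc r ^ (2 * j) ≤ (1 + r) ^ (2 * j) := by gcongr; linarith
    _ = (1 + r) ^ ((2 * j : ℕ) : ℝ) := (Real.rpow_natCast _ _).symm
    _ ≤ (1 + r) ^ L := Real.rpow_le_rpow_of_exponent_le (by linarith) (by push_cast; linarith)

/-- A one-sided bound on an `m`-polyharmonic function controls its `L¹` means. -/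
theorem exists_radialMean_abs_le {m : ℕ} (hm : 1 ≤ m) {h : EuclideanSpace ℝ (Fin n) → ℝ}
    (hsmooth : ContDiff ℝ (⊤ : ℕ∞) h) (hpoly : ∀ x, lapIter m h x = 0) {C l L : ℝ}
    (hC : 0 ≤ C) (hl : 0 ≤ l) (hbound : ∀ x, h x ≤ C * (1 + ‖x‖ ^ l)) (hlL : l ≤ L)
    (hmL : 2 * (m : ℝ) - 2 ≤ L) :
    ∃ B, 0 ≤ B ∧ ∀ r, 0 ≤ r → radialMean cutoff (fun x => |h x|) 0 r ≤ B * (1 + r) ^ L := by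
  obtain ⟨P, hP, hPF⟩ := exists_polynomial_radialMean m contDiff_cutoff cutoff_eq_zero
    hsmooth hpoly 0
  obtain ⟨B, hB, hPB⟩ := exists_abs_eval_sq_le hm P hP
  have hM := integral_cutoff_pos (n := n)
  set M := ∫ y : EuclideanSpace ℝ (Fin n), cutoff (‖y‖ ^ 2) with hMdef
  refine ⟨4 * C * M + B, by positivity, fun r hr => ?_⟩
  have hcont : Continuous fun y : EuclideanSpace ℝ (Fin n) => h (0 + r • y) :=
    hsmooth.continuous.comp (by fun_prop)
  have hle : radialMean cutoff (fun x => |h x|) 0 r ≤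
      2 * C * (1 + r ^ l) * M - radialMean cutoff h 0 r := by
    rw [hMdef, radialMean, radialMean, ← integral_const_mul,
      ← integral_sub (integrable_cutoff.const_mul _) (integrable_mul_cutoff hcont)]
    refine integral_mono (integrable_mul_cutoff hcont.abs)
      ((integrable_cutoff.const_mul _).sub (integrable_mul_cutoff hcont)) fun y => ?_
    simp only
    rw [← sub_mul]
    by_cases hy : ‖y‖ ≤ 1
    · refine mul_le_mul_of_nonneg_right ?_ (cutoff_nonneg _)
      have h1 : h (0 + r • y) ≤ C * (1 + r ^ l) := by
        refine (hbound _).trans ?_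
        gcongr
        rw [zero_add, norm_smul, Real.norm_of_nonneg hr]
        exact mul_le_of_le_one_right hr hy
      have h2 : 0 ≤ C * (1 + r ^ l) := by positivity
      rcases abs_cases (h (0 + r • y)) with h3 | h3 <;> linarith
    · rw [cutoff_eq_zero (‖y‖ ^ 2) (by nlinarith [not_le.1 hy]), mul_zero, mul_zero]
  have hrl : 1 + r ^ l ≤ 2 * (1 + r) ^ L := by
    have h1 : 1 ≤ (1 + r) ^ L := Real.one_le_rpow (by linarith) (hl.trans hlL)
    have h2 : r ^ l ≤ (1 + r) ^ L :=
      (Real.rpow_le_rpow hr (by linarith) hl).trans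
        (Real.rpow_le_rpow_of_exponent_le (by linarith) hlL)
    linarith
  have hF : -radialMean cutoff h 0 r ≤ B * (1 + r) ^ L := by
    rw [hPF]
    exact (neg_le_abs _).trans (hPB r L hr hmL)
  calc radialMean cutoff (fun x => |h x|) 0 r
      ≤ 2 * C * (1 + r ^ l) * M - radialMean cutoff h 0 r := hle
    _ ≤ 2 * C * (2 * (1 + r) ^ L) * M + B * (1 + r) ^ L := by
        rw [sub_eq_add_neg]
        gcongr
    _ = (4 * C * M + B) * (1 + r) ^ L := by ring

theorem abs_radialMean_cutoff_le (f : EuclideanSpace ℝ (Fin n) → ℝ)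
    (x : EuclideanSpace ℝ (Fin n)) (r : ℝ) :
    |radialMean cutoff f x r| ≤ radialMean cutoff (fun x => |f x|) x r := by
  refine (abs_integral_le_integral_abs).trans_eq ?_
  simp [radialMean, abs_mul, abs_of_nonneg (cutoff_nonneg _)]

/-- A one-sided polynomial bound on an `m`-polyharmonic function implies a two-sided one. -/
theorem exists_abs_le_of_le {m : ℕ} (hm : 1 ≤ m) {h : EuclideanSpace ℝ (Fin n) → ℝ}
    (hsmooth : ContDiff ℝ (⊤ : ℕ∞) h) (hpoly : ∀ x, lapIter m h x = 0) {C l L : ℝ}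
    (hC : 0 ≤ C) (hl : 0 ≤ l) (hbound : ∀ x, h x ≤ C * (1 + ‖x‖ ^ l)) (hlL : l ≤ L)
    (hmL : 2 * (m : ℝ) - 2 ≤ L) :
    ∃ A, ∀ x, |h x| ≤ A * (1 + ‖x‖) ^ L := by
  obtain ⟨c, hc⟩ := exists_reproducing_weights (n := n) m contDiff_cutoff cutoff_eq_zero
  obtain ⟨B, hB, hBr⟩ := exists_radialMean_abs_le hm hsmooth hpoly hC hl hbound hlL hmL
  have hM := integral_cutoff_pos (n := n)
  have hrep := hc h hsmooth hpoly
  set M := ∫ y : EuclideanSpace ℝ (Fin n), cutoff (‖y‖ ^ 2)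
  set D := 4 ^ n * (B * (4 * (m : ℝ) + 1) ^ L) with hD
  refine ⟨M⁻¹ * ((∑ k ∈ Finset.range m, |c k|) * D), fun x => ?_⟩
  set R := 1 + ‖x‖ with hR
  have hR1 : 1 ≤ R := by linarith [norm_nonneg x]
  have hmean (k : ℕ) (hk : k ∈ Finset.range m) :
      |radialMean cutoff h x (((k : ℝ) + 1) * R)| ≤ D * R ^ L := by
    set s := ((k : ℝ) + 1) * R
    have hsR : R ≤ s := by nlinarith [(Nat.cast_nonneg k : (0 : ℝ) ≤ k)]
    have hkm : (k : ℝ) + 1 ≤ m := by exact_mod_cast Finset.mem_range.1 hk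
    have hsm : s ≤ m * R := mul_le_mul_of_nonneg_right hkm (by linarith)
    calc |radialMean cutoff h x s|
        ≤ radialMean cutoff (fun x => |h x|) x s := abs_radialMean_cutoff_le h x s
      _ ≤ 4 ^ n * radialMean cutoff (fun x => |h x|) 0 (4 * s) :=
          integral_comp_affine_mul_cutoff_le hsmooth.continuous.abs (fun _ => abs_nonneg _)
            (by linarith) (by linarith)
      _ ≤ 4 ^ n * (B * (1 + 4 * s) ^ L) := by
          gcongr
          exact hBr _ (by linarith)
      _ ≤ 4 ^ n * (B * ((4 * (m : ℝ) + 1) * R) ^ L) := by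
          have h0 : 0 ≤ 1 + 4 * s := by linarith
          have hL : 0 ≤ L := hl.trans hlL
          gcongr
          linarith
      _ = D * R ^ L := by
          rw [Real.mul_rpow (by positivity) (by linarith), hD]
          ring
  have hrepx := hrep x R
  rw [mul_assoc, inv_mul_eq_div, le_div_iff₀ hM, ← abs_of_pos hM, ← abs_mul, hrepx]
  refine (Finset.abs_sum_le_sum_abs _ _).trans ?_
  rw [mul_assoc, Finset.sum_mul]
  refine Finset.sum_le_sum fun k hk => ?_
  rw [abs_mul]
  exact mul_le_mul_of_nonneg_left (hmean k hk) (abs_nonneg _)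

end MeanValue

section PolynomialPrimitive

variable {n : ℕ}

/-- The polynomial `x ↦ ∫₀¹ q (t x) dt`. -/
noncomputable def rayAverage (q : MvPolynomial (Fin n) ℝ) : MvPolynomial (Fin n) ℝ :=
  ∑ α ∈ q.support, monomial α (q.coeff α / ((∑ i, α i : ℕ) + 1))

theorem totalDegree_rayAverage_le (q : MvPolynomial (Fin n) ℝ) :
    (rayAverage q).totalDegree ≤ q.totalDegree := by
  refine (totalDegree_finsetSum_le fun α hα => ?_)
  refine (totalDegree_monomial_le _ _).trans (le_totalDegree hα)

theorem hasDerivAt_mul_evalPoly_rayAverage (q : MvPolynomial (Fin n) ℝ)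
    (x : EuclideanSpace ℝ (Fin n)) (t : ℝ) :
    HasDerivAt (fun t : ℝ => t * evalPoly (rayAverage q) (t • x)) (evalPoly q (t • x)) t := by
  have h1 (t : ℝ) : t * evalPoly (rayAverage q) (t • x) = ∑ α ∈ q.support,
      (q.coeff α / ((∑ i, α i : ℕ) + 1) * ∏ i, x i ^ α i) * t ^ ((∑ i, α i) + 1) := by
    simp only [evalPoly, rayAverage, map_sum, eval_monomial, Finset.mul_sum]
    refine Finset.sum_congr rfl fun α _ => ?_
    rw [Finsupp.prod_fintype _ _ (by simp)]
    simp only [PiLp.smul_apply, smul_eq_mul, mul_pow, Finset.prod_mul_distrib,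
      Finset.prod_pow_eq_pow_sum]
    ring
  have h2 : evalPoly q (t • x) = ∑ α ∈ q.support,
      (q.coeff α / ((∑ i, α i : ℕ) + 1) * ∏ i, x i ^ α i) *
        (((∑ i, α i) + 1 : ℕ) * t ^ (∑ i, α i)) := by
    rw [evalPoly, eval_eq']
    refine Finset.sum_congr rfl fun α _ => ?_
    simp only [PiLp.smul_apply, smul_eq_mul, mul_pow, Finset.prod_mul_distrib,
      Finset.prod_pow_eq_pow_sum]
    have : ((∑ i, α i : ℕ) : ℝ) + 1 ≠ 0 := by positivity
    rw [Nat.cast_add_one]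
    field_simp
  simp only [h1, h2]
  exact HasDerivAt.fun_sum fun α _ => (hasDerivAt_pow _ t).const_mul _

theorem exists_evalPoly_of_dirDeriv {u : EuclideanSpace ℝ (Fin n) → ℝ}
    (hu : ContDiff ℝ (⊤ : ℕ∞) u) {d : ℕ} (q : Fin n → MvPolynomial (Fin n) ℝ)
    (hq : ∀ i x, dirDeriv (EuclideanSpace.single i 1) u x = evalPoly (q i) x)
    (hd : ∀ i, (q i).totalDegree ≤ d) :
    ∃ p : MvPolynomial (Fin n) ℝ, (∀ x, u x = evalPoly p x) ∧ p.totalDegree ≤ d + 1 := by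
  refine ⟨C (u 0) + ∑ i, X i * rayAverage (q i), fun x => ?_, ?_⟩
  · have hder (t : ℝ) : HasDerivAt (fun t : ℝ => u (0 + t • x) -
        ∑ i, x i * (t * evalPoly (rayAverage (q i)) (t • x))) 0 t := by
      refine ((hasDerivAt_comp_line hu 0 x t).sub (HasDerivAt.fun_sum fun i _ =>
        (hasDerivAt_mul_evalPoly_rayAverage (q i) x t).const_mul (x i))).congr_deriv ?_
      rw [fderiv_apply_eq_sum]
      simp [hq]
    have := is_const_of_deriv_eq_zero (fun t => (hder t).differentiableAt)
      (fun t => (hder t).deriv) 1 0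
    simp only [one_smul, zero_smul, zero_add, add_zero, one_mul, zero_mul, mul_zero,
      Finset.sum_const_zero, sub_zero] at this
    simp only [evalPoly, map_add, map_sum, map_mul, eval_C, eval_X] at this ⊢
    linarith
  · refine (totalDegree_add _ _).trans (max_le (by simp) ?_)
    refine totalDegree_finsetSum_le fun i _ => (totalDegree_mul _ _).trans ?_
    rw [totalDegree_X, add_comm]
    exact Nat.add_le_add_right ((totalDegree_rayAverage_le _).trans (hd i)) 1

end PolynomialPrimitive

/-- A polyharmonic function of polynomial growth is a polynomial. -/
theorem exists_evalPoly_of_abs_le {n m : ℕ} {u : EuclideanSpace ℝ (Fin n) → ℝ}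
    (hu : ContDiff ℝ (⊤ : ℕ∞) u) (hm : ∀ x, lapIter m u x = 0) {A L : ℝ} (hL : 0 ≤ L)
    (hA : ∀ x, |u x| ≤ A * (1 + ‖x‖) ^ L) :
    ∃ p : MvPolynomial (Fin n) ℝ, (∀ x, u x = evalPoly p x) ∧ (p.totalDegree : ℝ) ≤ L := by
  obtain ⟨k, hk⟩ := exists_nat_gt L
  induction k generalizing u A L with
  | zero => exact absurd hL (by simpa using hk)
  | succ k ih =>
    rcases lt_or_ge L 1 with hL1 | hL1
    · refine ⟨C (u 0), fun x => ?_, by simpa using hL⟩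
      have hzero (x : EuclideanSpace ℝ (Fin n)) : fderiv ℝ u x = 0 := by
        ext v
        obtain ⟨K, hK⟩ := exists_dirDeriv_bound hu hm hL hA v
        have hlim : Filter.Tendsto (fun R : ℝ => K * R ^ (L - 1)) Filter.atTop (nhds 0) := by
          simpa using (tendsto_rpow_neg_atTop (sub_pos.2 hL1)).const_mul K
        have := ge_of_tendsto hlim ((Filter.eventually_ge_atTop (1 + ‖x‖)).mono (hK x))
        simpa [dirDeriv] using this
      simpa [evalPoly] using is_const_of_fderiv_eq_zero (hu.differentiable (by simp)) hzero x 0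
    · have hpartial (i : Fin n) : ∃ q : MvPolynomial (Fin n) ℝ,
          (∀ x, dirDeriv (EuclideanSpace.single i 1) u x = evalPoly q x) ∧
            (q.totalDegree : ℝ) ≤ L - 1 := by
        obtain ⟨K, hK⟩ := exists_dirDeriv_bound hu hm hL hA (EuclideanSpace.single i 1)
        exact ih (hu.dirDeriv (EuclideanSpace.single i 1)) (lapIter_dirDeriv_eq_zero hu hm _)
          (sub_nonneg.2 hL1) (fun x => hK x _ le_rfl) (by push_cast at hk; linarith)
      choose q hq hqd using hpartial
      obtain ⟨p, hp, hpd⟩ := exists_evalPoly_of_dirDeriv hu q hq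
        fun i => Nat.le_floor (hqd i)
      refine ⟨p, hp, (Nat.cast_le.2 hpd).trans ?_⟩
      have := Nat.floor_le (sub_nonneg.2 hL1)
      push_cast
      linarith

/-- A smooth `m`-polyharmonic function on `ℝⁿ` bounded above by `C(1 + |x|^l)` is a
polynomial of degree at most `max {l, 2m − 2}`. -/
theorem polyharmonic_liouville (n m : ℕ) (hm : 1 ≤ m)
    (h : EuclideanSpace ℝ (Fin n) → ℝ) (hsmooth : ContDiff ℝ (⊤ : ℕ∞) h)
    (hpoly : ∀ x, lapIter m h x = 0)
    (C l : ℝ) (hC : 0 < C) (hl : 0 ≤ l)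
    (hbound : ∀ x : EuclideanSpace ℝ (Fin n), h x ≤ C * (1 + ‖x‖ ^ l)) :
    ∃ p : MvPolynomial (Fin n) ℝ,
      (∀ x, h x = evalPoly p x) ∧
      (p.totalDegree : ℝ) ≤ max l (2 * (m : ℝ) - 2) := by
  obtain ⟨A, hA⟩ := exists_abs_le_of_le hm hsmooth hpoly hC.le hl hbound
    (le_max_left l (2 * (m : ℝ) - 2)) (le_max_right _ _)
  exact exists_evalPoly_of_abs_le hsmooth hpoly (hl.trans (le_max_left _ _)) hA
end
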